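/- Fix constants 0 < c1 ≤ c2, ε > 0 and an integer j ≥ 0. There exists C = C(c1, c2, ε, j) such that the following holds: for every T > 1, every integer d ≥ 2 with c1·T ≤ d ≤ c2·T, and every r_f = i·ρ_f with ρ_f ∈ ℝ and c1·T ≤ |ρ_f| ≤ c2·T, the function y ↦ Φ_{w4}(y; d) is j times continuously differentiable on ℝ∖{0} and satisfies |y|^j · |Φ_{w4}^{(j)}(y; d)| ≤ C · T^{3+ε} · (T + |y|^{1/3})^j for all real y ≠ 0. -/

import Mathlib

open MeasureTheory Finset Set
open scoped Real

noncomputable section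

/-- `e(x) = exp(2πi x)`. -/
def eFn (x : ℝ) : ℂ := Complex.exp (2 * (Real.pi : ℂ) * Complex.I * (x : ℂ))

/-- `Q(d,s) = Γ((d−1)/2 + s)/Γ((d+1)/2 − s)`. -/
def Qfun (d : ℕ) (s : ℂ) : ℂ :=
  Complex.Gamma (((d : ℂ) - 1) / 2 + s) / Complex.Gamma (((d : ℂ) + 1) / 2 - s)

/-- The `w₄` Bessel kernel `K_{w₄}(y; d, r)`, written as an integral over the vertical
line `Re s = 1/12` (a fixed choice of `σ ∈ (0, 1/6)`; the value is independent of this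
choice): `K_{w₄}(y;d,r) = ((εi)^d/4π²) ∫ |8π³y|^{1−r−s} Q(d,s) Γ(s+3r) e^{εiπ(s+3r)/2}
ds/(2πi)` with `ε = sgn y`. -/
def Kw4 (y : ℝ) (d : ℕ) (r : ℂ) : ℂ :=
  (((Real.sign y : ℂ) * Complex.I) ^ d / (4 * (Real.pi : ℂ) ^ 2)) *
    (1 / (2 * (Real.pi : ℂ))) *
    ∫ t : ℝ,
      ((|8 * Real.pi ^ 3 * y| : ℝ) : ℂ) ^
          ((1 : ℂ) - r - ((1 / 12 : ℂ) + (t : ℂ) * Complex.I)) *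
        Qfun d ((1 / 12 : ℂ) + (t : ℂ) * Complex.I) *
        Complex.Gamma ((1 / 12 : ℂ) + (t : ℂ) * Complex.I + 3 * r) *
        Complex.exp ((Real.sign y : ℂ) * Complex.I * (Real.pi : ℂ) *
          ((1 / 12 : ℂ) + (t : ℂ) * Complex.I + 3 * r) / 2)

/-- The spectral density `spec^d(r) = (1/8π³)(d−1)((d−1)²/4 − 9r²)`. -/
def specd (d : ℕ) (r : ℂ) : ℂ :=
  (1 / (8 * (Real.pi : ℂ) ^ 3)) * ((d : ℂ) - 1) * (((d : ℂ) - 1) ^ 2 / 4 - 9 * r ^ 2)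

/-- The spectral test function `F(r) = exp((r − r_f)²/T^ε)` with `r_f = iρ_f`. -/
def Ffun (T ε0 ρf : ℝ) (r : ℂ) : ℂ :=
  Complex.exp ((r - Complex.I * (ρf : ℂ)) ^ 2 / ((T ^ ε0 : ℝ) : ℂ))

/-- `Φ_{w₄}(y; d) = (1/|y|) ∫_{(0)} F(r) K_{w₄}(y; d, r) spec^d(r) dr/(2πi)`,
written as `(1/|y|)(1/2π) ∫_ℝ F(it) K_{w₄}(y; d, it) spec^d(it) dt`. -/
def Phiw4 (T ε0 ρf : ℝ) (d : ℕ) (y : ℝ) : ℂ :=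
  (1 / ((|y| : ℝ) : ℂ)) * (1 / (2 * (Real.pi : ℂ))) *
    ∫ t : ℝ, Ffun T ε0 ρf ((t : ℂ) * Complex.I) * Kw4 y d ((t : ℂ) * Complex.I) *
      specd d ((t : ℂ) * Complex.I)

lemma beta_norm_le {z : ℂ} (hz : 0 < z.re) {l : ℝ} (hl : 0 < l) :
    ‖Complex.betaIntegral z (l : ℂ)‖ ≤ (Complex.betaIntegral (z.re : ℂ) (l : ℂ)).re := by
  have hconv := Complex.betaIntegral_convergent (u := (z.re : ℂ)) (v := (l : ℂ)) (by simpa using hz)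
    (by simpa using hl)
  have key : ∀ x ∈ Ioo (0:ℝ) 1, ((x : ℂ) ^ ((z.re : ℂ) - 1) * (1 - (x : ℂ)) ^ ((l : ℂ) - 1)) =
      ((x ^ (z.re - 1) * (1 - x) ^ (l - 1) : ℝ) : ℂ) := by
    intro x hx
    push_cast
    rw [Complex.ofReal_cpow hx.1.le, show (1 - (x:ℂ)) = ((1 - x : ℝ) : ℂ) by push_cast; ring,
      Complex.ofReal_cpow (by linarith [hx.2])]
    push_cast
    rfl
  have key2 : ∀ x ∈ Ioo (0:ℝ) 1, ‖((x : ℂ) ^ (z - 1) * (1 - (x : ℂ)) ^ ((l : ℂ) - 1))‖ =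
      x ^ (z.re - 1) * (1 - x) ^ (l - 1) := by
    intro x hx
    rw [norm_mul, Complex.norm_cpow_eq_rpow_re_of_pos hx.1,
      show (1 - (x:ℂ)) = ((1 - x : ℝ) : ℂ) by push_cast; ring,
      Complex.norm_cpow_eq_rpow_re_of_pos (by linarith [hx.2])]
    simp
  have e1 : Complex.betaIntegral (z.re : ℂ) (l : ℂ) =
      ((∫ x in (0:ℝ)..1, x ^ (z.re - 1) * (1 - x) ^ (l - 1) : ℝ) : ℂ) := by
    rw [← intervalIntegral.integral_ofReal, Complex.betaIntegral]
    rw [intervalIntegral.integral_of_le zero_le_one, intervalIntegral.integral_of_le zero_le_one,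
      integral_Ioc_eq_integral_Ioo, integral_Ioc_eq_integral_Ioo]
    exact setIntegral_congr_fun measurableSet_Ioo key
  rw [e1, Complex.ofReal_re, Complex.betaIntegral]
  refine (intervalIntegral.norm_integral_le_integral_norm zero_le_one).trans (le_of_eq ?_)
  rw [intervalIntegral.integral_of_le zero_le_one, intervalIntegral.integral_of_le zero_le_one,
      integral_Ioc_eq_integral_Ioo, integral_Ioc_eq_integral_Ioo]
  exact setIntegral_congr_fun measurableSet_Ioo key2

lemma beta_decay {z : ℂ} (hz : 0 < z.re) {l : ℝ} (hl : 0 < l) (hl1 : l < 1) {h : ℝ} (hh : 0 < h)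
    (hh2 : h ≤ 1 / 2) :
    ‖Complex.betaIntegral z (l : ℂ)‖ ≤ 2 * h ^ l / l + 2 * h ^ (l - 1) / ‖z‖ := by
  have hz0 : z ≠ 0 := by rintro rfl; simp at hz
  have hconv := Complex.betaIntegral_convergent (u := z) (v := (l : ℂ)) hz (by simpa using hl)
  have hle : (0:ℝ) ≤ 1 - h := by linarith
  have hI1 : IntervalIntegrable (fun x : ℝ => (x : ℂ) ^ (z - 1) * (1 - (x : ℂ)) ^ ((l : ℂ) - 1))
      volume 0 (1 - h) := hconv.mono_set (by
        rw [Set.uIcc_of_le hle, Set.uIcc_of_le zero_le_one]; exact Set.Icc_subset_Icc le_rfl (by linarith))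
  have hI2 : IntervalIntegrable (fun x : ℝ => (x : ℂ) ^ (z - 1) * (1 - (x : ℂ)) ^ ((l : ℂ) - 1))
      volume (1 - h) 1 := hconv.mono_set (by
        rw [Set.uIcc_of_le (by linarith), Set.uIcc_of_le zero_le_one]; exact Set.Icc_subset_Icc hle le_rfl)
  have split : Complex.betaIntegral z (l : ℂ) =
      (∫ x in (0:ℝ)..(1-h), (x : ℂ) ^ (z - 1) * (1 - (x : ℂ)) ^ ((l : ℂ) - 1)) +
      ∫ x in (1-h)..1, (x : ℂ) ^ (z - 1) * (1 - (x : ℂ)) ^ ((l : ℂ) - 1) := by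
    rw [Complex.betaIntegral, intervalIntegral.integral_add_adjacent_intervals hI1 hI2]
  -- near part
  have near : ‖∫ x in (1-h)..1, (x : ℂ) ^ (z - 1) * (1 - (x : ℂ)) ^ ((l : ℂ) - 1)‖ ≤
      2 * h ^ l / l := by
    have e : ∫ x in (1-h)..1, 2 * (1 - x) ^ (l - 1) = 2 * h ^ l / l := by
      rw [intervalIntegral.integral_const_mul,
        intervalIntegral.integral_comp_sub_left (fun x : ℝ => x ^ (l - 1)) 1]
      rw [integral_rpow (Or.inl (by linarith))]
      simp only [sub_self, sub_sub_cancel, sub_add_cancel]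
      rw [Real.zero_rpow hl.ne']
      ring
    rw [← e]
    have hIntg : IntervalIntegrable (fun x : ℝ => 2 * (1 - x) ^ (l - 1)) volume (1 - h) 1 := by
      apply IntervalIntegrable.const_mul
      have := (intervalIntegral.intervalIntegrable_rpow' (a := 0) (b := h) (r := l - 1)
        (by linarith)).comp_sub_left 1
      simpa using this.symm
    refine intervalIntegral.norm_integral_le_of_norm_le (by linarith) ?_ hIntg
    rw [← ae_restrict_iff' measurableSet_Ioc, ← restrict_Ioo_eq_restrict_Ioc,
      ae_restrict_iff' measurableSet_Ioo]
    refine Filter.Eventually.of_forall fun x hx => ?_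
    have hx0 : 0 < x := by linarith [hx.1]
    have hx1 : 0 < 1 - x := by linarith [hx.2]
    rw [norm_mul, Complex.norm_cpow_eq_rpow_re_of_pos hx0,
      show (1 - (x:ℂ)) = ((1 - x : ℝ) : ℂ) by push_cast; ring,
      Complex.norm_cpow_eq_rpow_re_of_pos hx1]
    simp only [Complex.sub_re, Complex.one_re, Complex.ofReal_re]
    gcongr
    calc x ^ (z.re - 1) ≤ x ^ (-1 : ℝ) :=
          Real.rpow_le_rpow_of_exponent_ge hx0 hx.2.le (by linarith)
      _ = x⁻¹ := Real.rpow_neg_one x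
      _ ≤ 2 := by rw [inv_le_comm₀ hx0 two_pos]; linarith [hx.1]
  -- far part
  have far : ‖∫ x in (0:ℝ)..(1-h), (x : ℂ) ^ (z - 1) * (1 - (x : ℂ)) ^ ((l : ℂ) - 1)‖ ≤
      2 * h ^ (l - 1) / ‖z‖ := by
    have hcu : ∀ x ∈ Icc 0 (1-h), (0:ℝ) < 1 - x := fun x hx => by linarith [hx.2]
    have hdu : ∀ x : ℝ, 0 < 1 - x → HasDerivAt (fun x : ℝ => (1 - (x : ℂ)) ^ ((l : ℂ) - 1))
        (-(((l : ℂ) - 1) * (1 - (x : ℂ)) ^ ((l : ℂ) - 2))) x := by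
      intro x hx
      have h1 : HasDerivAt (fun w : ℂ => (1 - w)) (-1) (x:ℂ) := by
        simpa using (hasDerivAt_id (x:ℂ)).const_sub 1
      have h2 := (h1.cpow_const (c := (l:ℂ) - 1) (by
        rw [show (1 - (x:ℂ)) = ((1 - x : ℝ) : ℂ) by push_cast; ring]
        exact Complex.ofReal_mem_slitPlane.2 hx)).comp_ofReal
      refine h2.congr_deriv ?_
      rw [show (l:ℂ) - 1 - 1 = (l:ℂ) - 2 by ring]
      ring
    have hdv : ∀ x : ℝ, 0 < x → HasDerivAt (fun x : ℝ => (x : ℂ) ^ z / z) ((x:ℂ) ^ (z - 1)) x := by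
      intro x hx
      have h1 := (hasDerivAt_id (x:ℂ))
      have h2 := ((h1.cpow_const (c := z)
        (by exact Complex.ofReal_mem_slitPlane.2 hx)).div_const z).comp_ofReal
      refine h2.congr_deriv ?_
      simp
      field_simp
    have hcontu : ContinuousOn (fun x : ℝ => (1 - (x : ℂ)) ^ ((l : ℂ) - 1)) (Icc 0 (1-h)) :=
      fun x hx => (hdu x (hcu x hx)).continuousAt.continuousWithinAt
    have hcontu' : ContinuousOn (fun x : ℝ => -(((l : ℂ) - 1) * (1 - (x : ℂ)) ^ ((l : ℂ) - 2)))
        (Icc 0 (1-h)) := by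
      intro x hx
      have := hcu x hx
      apply ContinuousAt.continuousWithinAt
      apply ContinuousAt.neg
      apply ContinuousAt.mul continuousAt_const
      apply ContinuousAt.cpow (by fun_prop) continuousAt_const
      rw [show (1 - (x:ℂ)) = ((1 - x : ℝ) : ℂ) by push_cast; ring]
      exact Complex.ofReal_mem_slitPlane.2 this
    have hcontv : ContinuousOn (fun x : ℝ => (x : ℂ) ^ z / z) (Icc 0 (1-h)) := by
      apply ContinuousOn.div_const
      intro x hx
      exact (Complex.continuous_ofReal_cpow_const hz).continuousWithinAt
    have hparts := intervalIntegral.integral_mul_deriv_eq_deriv_mul_of_hasDerivAt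
      (a := 0) (b := 1 - h) (u := fun x : ℝ => (1 - (x : ℂ)) ^ ((l : ℂ) - 1))
      (v := fun x : ℝ => (x : ℂ) ^ z / z)
      (u' := fun x : ℝ => -(((l : ℂ) - 1) * (1 - (x : ℂ)) ^ ((l : ℂ) - 2)))
      (v' := fun x : ℝ => (x:ℂ) ^ (z - 1))
      (by rwa [Set.uIcc_of_le hle]) (by rwa [Set.uIcc_of_le hle])
      (by
        intro x hx
        rw [min_eq_left hle, max_eq_right hle] at hx
        exact hdu x (by linarith [hx.2]))
      (by
        intro x hx
        rw [min_eq_left hle, max_eq_right hle] at hx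
        exact hdv x hx.1)
      (ContinuousOn.intervalIntegrable (by rwa [Set.uIcc_of_le hle]))
      (intervalIntegral.intervalIntegrable_cpow' (by simpa using hz))
    have hcomm : (∫ x in (0:ℝ)..(1-h), (x : ℂ) ^ (z - 1) * (1 - (x : ℂ)) ^ ((l : ℂ) - 1)) =
      ∫ x in (0:ℝ)..(1-h), (1 - (x : ℂ)) ^ ((l : ℂ) - 1) * (x : ℂ) ^ (z - 1) := by
      congr 1; ext x; ring
    rw [hcomm, hparts]
    simp only [Complex.ofReal_zero, Complex.zero_cpow hz0, zero_div, mul_zero, sub_zero]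
    have b1 : ‖(1 - ((1 - h : ℝ) : ℂ)) ^ ((l : ℂ) - 1) * (((1 - h : ℝ) : ℂ) ^ z / z)‖ ≤
        h ^ (l - 1) / ‖z‖ := by
      rw [norm_mul, norm_div, show (1 - ((1 - h : ℝ) : ℂ)) = ((h : ℝ) : ℂ) by push_cast; ring,
        Complex.norm_cpow_eq_rpow_re_of_pos hh, Complex.norm_cpow_eq_rpow_re_of_pos (by linarith)]
      simp only [Complex.sub_re, Complex.one_re, Complex.ofReal_re]
      have : (1 - h) ^ z.re ≤ 1 := Real.rpow_le_one hle (by linarith) hz.le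
      rw [div_eq_mul_one_div (h ^ (l-1))]
      gcongr
    have b2 : ‖∫ x in (0:ℝ)..(1-h), -(((l : ℂ) - 1) * (1 - (x : ℂ)) ^ ((l : ℂ) - 2)) *
        ((x : ℂ) ^ z / z)‖ ≤ h ^ (l - 1) / ‖z‖ := by
      have e : ∫ x in (0:ℝ)..(1-h), ((1 - l) / ‖z‖) * (1 - x) ^ (l - 2) =
          (h ^ (l - 1) - 1) / ‖z‖ := by
        rw [intervalIntegral.integral_const_mul,
          intervalIntegral.integral_comp_sub_left (fun x : ℝ => x ^ (l - 2)) 1]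
        rw [integral_rpow (Or.inr ⟨by linarith, by
          rw [sub_sub_cancel, sub_zero, Set.uIcc_of_le (by linarith)]; intro hx; linarith [hx.1]⟩)]
        rw [show l - 2 + 1 = l - 1 by ring, sub_sub_cancel, sub_zero, Real.one_rpow]
        have : l - 1 ≠ 0 := by linarith
        have : ‖z‖ ≠ 0 := by simpa using hz0
        field_simp
        ring
      have hIntg : IntervalIntegrable (fun x : ℝ => ((1 - l) / ‖z‖) * (1 - x) ^ (l - 2)) volume
          0 (1 - h) := by
        apply ContinuousOn.intervalIntegrable
        rw [Set.uIcc_of_le hle]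
        intro x hx
        have := hcu x hx
        apply ContinuousAt.continuousWithinAt
        apply ContinuousAt.mul continuousAt_const
        exact ContinuousAt.rpow_const (by fun_prop) (Or.inl this.ne')
      calc _ ≤ ∫ x in (0:ℝ)..(1-h), ((1 - l) / ‖z‖) * (1 - x) ^ (l - 2) := by
            refine intervalIntegral.norm_integral_le_of_norm_le hle ?_ hIntg
            refine Filter.Eventually.of_forall fun x hx => ?_
            have hx1 : 0 < 1 - x := by linarith [hx.2]
            rw [norm_mul, norm_neg, norm_mul, norm_div,
              show (1 - (x:ℂ)) = ((1 - x : ℝ) : ℂ) by push_cast; ring,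
              Complex.norm_cpow_eq_rpow_re_of_pos hx1, Complex.norm_cpow_eq_rpow_re_of_pos hx.1]
            have h3 : ‖(l:ℂ) - 1‖ = 1 - l := by
              rw [show (l:ℂ) - 1 = ((l - 1 : ℝ) : ℂ) by push_cast; ring, Complex.norm_real,
                Real.norm_eq_abs, abs_of_neg (by linarith)]
              ring
            have h4 : x ^ z.re ≤ 1 := Real.rpow_le_one hx.1.le (by linarith [hx.2]) hz.le
            have h5 : ((l:ℂ) - 2).re = l - 2 := by simp
            rw [h3, h5]
            calc (1 - l) * (1 - x) ^ (l - 2) * (x ^ z.re / ‖z‖) ≤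
                (1 - l) * (1 - x) ^ (l - 2) * (1 / ‖z‖) := by
                  have : 0 ≤ 1 - l := by linarith
                  gcongr
              _ = _ := by ring
        _ = (h ^ (l - 1) - 1) / ‖z‖ := e
        _ ≤ _ := by gcongr; linarith
    calc _ ≤ _ := norm_sub_le _ _
      _ ≤ h ^ (l - 1) / ‖z‖ + h ^ (l - 1) / ‖z‖ := add_le_add b1 b2
      _ = _ := by ring
  rw [split]
  calc _ ≤ _ := norm_add_le _ _
    _ ≤ _ := by linarith

/-- Stirling-type comparison on a vertical line. -/
lemma gamma_ratio_decay {x l : ℝ} (hx : 0 < x) (hl : 0 < l) (hl1 : l < 1) :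
    ∃ C : ℝ, 0 < C ∧ ∀ t : ℝ, ‖Complex.Gamma (x + t * Complex.I)‖ ≤
      C * (1 + |t|) ^ (-l) * ‖Complex.Gamma (x + l + t * Complex.I)‖ := by
  have hG : 0 < Real.Gamma l := Real.Gamma_pos_of_pos hl
  set m := min x 1 / 2 with hm
  have hm0 : 0 < m := by positivity
  refine ⟨(2 * 2 ^ (-l) / l + 2 * 2 ^ (-(l-1)) / m) / Real.Gamma l, by positivity, fun t => ?_⟩
  set z : ℂ := x + t * Complex.I with hzdef
  have hzre : z.re = x := by simp [hzdef]
  have hzim : z.im = t := by simp [hzdef]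
  have hz : 0 < z.re := by rw [hzre]; exact hx
  have hzn : m * (1 + |t|) ≤ ‖z‖ := by
    have h1 := Complex.abs_re_le_norm z
    have h2 := Complex.abs_im_le_norm z
    rw [hzre, abs_of_pos hx] at h1
    rw [hzim] at h2
    have h3 : m ≤ x / 2 := by rw [hm]; gcongr; exact min_le_left _ _
    have h4 : m ≤ 1 / 2 := by rw [hm]; gcongr; exact min_le_right _ _
    nlinarith [abs_nonneg t]
  have ht1 : 0 < 1 + |t| := by positivity
  have hB := beta_decay hz hl hl1 (h := 1 / (2 * (1 + |t|))) (by positivity) (by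
    rw [div_le_div_iff₀ (by positivity) two_pos]; nlinarith [abs_nonneg t])
  have hprod := Complex.Gamma_mul_Gamma_eq_betaIntegral hz (t := (l:ℂ)) (by simpa using hl)
  have hp : ∀ a : ℝ, (1 / (2 * (1 + |t|))) ^ a = 2 ^ (-a) * (1 + |t|) ^ (-a) := by
    intro a
    rw [one_div, Real.inv_rpow (by positivity), ← Real.rpow_neg (by positivity),
      Real.mul_rpow (by positivity) (by positivity)]
  have hB2 : ‖Complex.betaIntegral z (l : ℂ)‖ ≤
      (2 * 2 ^ (-l) / l + 2 * 2 ^ (-(l-1)) / m) * (1 + |t|) ^ (-l) := by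
    refine hB.trans ?_
    rw [hp, hp]
    have e2 : (1 + |t|) ^ (-(l - 1)) = (1 + |t|) ^ (-l) * (1 + |t|) := by
      rw [show -(l-1) = -l + 1 by ring, Real.rpow_add ht1, Real.rpow_one]
    rw [e2, add_mul]
    apply add_le_add
    · apply le_of_eq; ring
    · calc 2 * (2 ^ (-(l - 1)) * ((1 + |t|) ^ (-l) * (1 + |t|))) / ‖z‖
          ≤ 2 * (2 ^ (-(l - 1)) * ((1 + |t|) ^ (-l) * (1 + |t|))) / (m * (1 + |t|)) := by
            gcongr
        _ = _ := by field_simp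
  have hn : ‖Complex.Gamma z‖ * Real.Gamma l =
      ‖Complex.Gamma (z + l)‖ * ‖Complex.betaIntegral z l‖ := by
    rw [← norm_mul, ← hprod, norm_mul, Complex.Gamma_ofReal, Complex.norm_real, Real.norm_eq_abs,
      abs_of_pos hG]
  have hzl : (x:ℂ) + l + t * Complex.I = z + l := by rw [hzdef]; ring
  rw [hzl]
  have : ‖Complex.Gamma z‖ = ‖Complex.Gamma (z + l)‖ * ‖Complex.betaIntegral z l‖ / Real.Gamma l := by
    rw [← hn]; field_simp
  rw [this]
  calc _ ≤ ‖Complex.Gamma (z + l)‖ * ((2 * 2 ^ (-l) / l + 2 * 2 ^ (-(l-1)) / m) * (1 + |t|) ^ (-l))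
        / Real.Gamma l := by gcongr
    _ = _ := by ring

lemma gamma_half_line (t : ℝ) :
    ‖Complex.Gamma (1 / 2 + t * Complex.I)‖ ≤ Real.sqrt (2 * π) * Real.exp (-(π * |t| / 2)) := by
  have h := Complex.Gamma_mul_Gamma_one_sub (1 / 2 + t * Complex.I)
  have hc : (1:ℂ) - (1 / 2 + t * Complex.I) = (starRingEnd ℂ) (1 / 2 + t * Complex.I) := by
    simp [Complex.ext_iff]; norm_num
  rw [hc, Complex.Gamma_conj, Complex.mul_conj] at h
  have hs : Complex.sin (π * (1 / 2 + t * Complex.I)) = (Real.cosh (π * t) : ℂ) := by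
    rw [show (π:ℂ) * (1 / 2 + t * Complex.I) = (π * t : ℝ) * Complex.I + π / 2 by push_cast; ring,
      Complex.sin_add_pi_div_two, Complex.cos_mul_I, Complex.ofReal_cosh]
  rw [hs] at h
  have h' : Complex.normSq (Complex.Gamma (1 / 2 + t * Complex.I)) = π / Real.cosh (π * t) := by
    exact_mod_cast h
  rw [Complex.normSq_eq_norm_sq] at h'
  have hcosh : Real.exp (π * |t|) / 2 ≤ Real.cosh (π * t) := by
    rw [← Real.cosh_abs, abs_mul, abs_of_pos Real.pi_pos, Real.cosh_eq]
    have := Real.exp_pos (-(π * |t|))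
    linarith
  refine le_of_sq_le_sq ?_ (by positivity)
  rw [h', mul_pow, Real.sq_sqrt (by positivity), ← Real.exp_nat_mul]
  rw [show ((2:ℕ):ℝ) * (-(π * |t| / 2)) = -(π * |t|) by push_cast; ring, Real.exp_neg]
  rw [div_le_iff₀ (Real.cosh_pos _)]
  have := Real.exp_pos (π * |t|)
  calc π = 2 * π * (Real.exp (π * |t|))⁻¹ * (Real.exp (π * |t|) / 2) := by field_simp
    _ ≤ _ := by gcongr

lemma integrable_exp_sub_exp_one {x : ℝ} (hx : 0 < x) :
    Integrable (fun p : ℝ => Real.exp (x * p - Real.exp p)) := by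
  have h := Real.GammaIntegral_convergent hx
  have himg : Real.exp '' univ = Set.Ioi (0:ℝ) := by rw [image_univ, Real.range_exp]
  rw [← himg, integrableOn_image_iff_integrableOn_abs_deriv_smul MeasurableSet.univ
    (fun p _ => (Real.hasDerivAt_exp p).hasDerivWithinAt) Real.exp_injective.injOn,
    integrableOn_univ] at h
  refine h.congr (Filter.Eventually.of_forall fun p => ?_)
  simp only [smul_eq_mul, abs_of_pos (Real.exp_pos p)]
  rw [← Real.exp_mul, ← Real.exp_add, ← Real.exp_add]
  congr 1; ring

lemma integrable_exp_sub_exp {x r : ℝ} (hx : 0 < x) (hr : 0 < r) :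
    Integrable (fun p : ℝ => Real.exp (x * p - r * Real.exp p)) := by
  have h := ((integrable_exp_sub_exp_one hx).comp_add_right (Real.log r)).const_mul
    (Real.exp (-(x * Real.log r)))
  refine h.congr (Filter.Eventually.of_forall fun p => ?_)
  simp only
  rw [← Real.exp_add, Real.exp_add p, Real.exp_log hr]
  congr 1; ring

lemma norm_cexp_sub_exp (a r : ℂ) (p : ℝ) :
    ‖Complex.exp (a * p - r * (Real.exp p : ℝ))‖ = Real.exp (a.re * p - r.re * Real.exp p) := by
  rw [Complex.norm_exp]
  congr 1
  simp only [Complex.sub_re, Complex.re_mul_ofReal]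

lemma integrable_cexp_sub_exp {a r : ℂ} (ha : 0 < a.re) (hr : 0 < r.re) :
    Integrable (fun p : ℝ => Complex.exp (a * p - r * (Real.exp p : ℝ))) := by
  refine (integrable_exp_sub_exp ha hr).mono' (by fun_prop) ?_
  exact Filter.Eventually.of_forall fun p => (norm_cexp_sub_exp a r p).le

lemma cexp_sub_exp_parts {a r : ℂ} (ha : 0 < a.re) (hr : 0 < r.re) :
    a * (∫ p : ℝ, Complex.exp (a * p - r * (Real.exp p : ℝ))) =
      r * ∫ p : ℝ, Complex.exp ((a + 1) * p - r * (Real.exp p : ℝ)) := by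
  have h1 := integrable_cexp_sub_exp ha hr
  have h2 := integrable_cexp_sub_exp (a := a + 1) (r := r) (by simp; linarith) hr
  have e : ∀ p : ℝ, HasDerivAt (fun p : ℝ => Complex.exp (a * p - r * (Real.exp p : ℝ)))
      (a * Complex.exp (a * p - r * (Real.exp p : ℝ)) -
        r * Complex.exp ((a + 1) * p - r * (Real.exp p : ℝ))) p := by
    intro p
    have hd : HasDerivAt (fun p : ℝ => a * (p:ℂ) - r * (Real.exp p : ℝ))
        (a * 1 - r * (Real.exp p : ℝ)) p := by
      refine ((hasDerivAt_id p).ofReal_comp.const_mul a).sub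
        ((Real.hasDerivAt_exp p).ofReal_comp.const_mul r)
    refine hd.cexp.congr_deriv ?_
    rw [show (a + 1) * (p:ℂ) - r * (Real.exp p : ℝ) = (a * p - r * (Real.exp p : ℝ)) + p by ring,
      Complex.exp_add _ (p:ℂ), Complex.ofReal_exp]
    ring
  have h := integral_eq_zero_of_hasDerivAt_of_integrable e
    ((h1.const_mul a).sub (h2.const_mul r)) h1
  rw [integral_sub (h1.const_mul a) (h2.const_mul r), integral_const_mul, integral_const_mul] at h
  exact sub_eq_zero.1 h

lemma cexp_sub_exp_deriv {a r : ℂ} (ha : 0 < a.re) (hr : 0 < r.re) :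
    HasDerivAt (fun r : ℂ => ∫ p : ℝ, Complex.exp (a * p - r * (Real.exp p : ℝ)))
      (-∫ p : ℝ, Complex.exp ((a + 1) * p - r * (Real.exp p : ℝ))) r := by
  have hs : {z : ℂ | r.re / 2 < z.re} ∈ nhds r :=
    (isOpen_lt continuous_const Complex.continuous_re).mem_nhds (by simp; linarith)
  have := hasDerivAt_integral_of_dominated_loc_of_deriv_le (μ := volume) (x₀ := r)
    (F := fun r : ℂ => fun p : ℝ => Complex.exp (a * p - r * (Real.exp p : ℝ)))
    (F' := fun r : ℂ => fun p : ℝ => -Complex.exp ((a + 1) * p - r * (Real.exp p : ℝ)))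
    (bound := fun p => Real.exp ((a + 1).re * p - r.re / 2 * Real.exp p))
    hs (Filter.Eventually.of_forall fun z => by fun_prop) (integrable_cexp_sub_exp ha hr)
    (by fun_prop)
    (Filter.Eventually.of_forall fun p z hz => by
      rw [norm_neg, norm_cexp_sub_exp]
      have : r.re / 2 < z.re := hz
      gcongr)
    (integrable_exp_sub_exp (by simp; linarith) (by linarith))
    (Filter.Eventually.of_forall fun p z hz => by
      have hd : HasDerivAt (fun z : ℂ => a * (p:ℂ) - z * (Real.exp p : ℝ))
        (-(1 * ((Real.exp p : ℝ) : ℂ))) z := ((hasDerivAt_id z).mul_const _).const_sub _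
      refine hd.cexp.congr_deriv ?_
      rw [show (a + 1) * (p:ℂ) - z * (Real.exp p : ℝ) = (a * p - z * (Real.exp p : ℝ)) + p by ring,
        Complex.exp_add _ (p:ℂ), Complex.ofReal_exp]
      ring)
  rw [← integral_neg]
  exact this.2

lemma gamma_cexp_integral_one {a : ℂ} (ha : 0 < a.re) :
    (∫ p : ℝ, Complex.exp (a * p - 1 * (Real.exp p : ℝ))) = Complex.Gamma a := by
  rw [Complex.Gamma_eq_integral ha, Complex.GammaIntegral]
  have himg : Real.exp '' univ = Set.Ioi (0:ℝ) := by rw [image_univ, Real.range_exp]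
  rw [← himg, integral_image_eq_integral_abs_deriv_smul MeasurableSet.univ
    (fun p _ => (Real.hasDerivAt_exp p).hasDerivWithinAt) Real.exp_injective.injOn,
    setIntegral_univ]
  congr 1; ext p
  rw [abs_of_pos (Real.exp_pos p), Complex.real_smul, Complex.ofReal_exp, Complex.ofReal_exp,
    Complex.ofReal_neg, Complex.ofReal_exp,
    Complex.cpow_def_of_ne_zero (Complex.exp_ne_zero _), Complex.log_exp (by simp [Real.pi_pos])
      (by simp [Real.pi_pos.le]), ← Complex.exp_add, ← Complex.exp_add]
  congr 1; ring

lemma gamma_cexp_integral {a r : ℂ} (ha : 0 < a.re) (hr : 0 < r.re) :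
    (∫ p : ℝ, Complex.exp (a * p - r * (Real.exp p : ℝ))) = r ^ (-a) * Complex.Gamma a := by
  set f : ℂ → ℂ := fun r => ∫ p : ℝ, Complex.exp (a * p - r * (Real.exp p : ℝ)) with hf
  have hslit : ∀ z : ℂ, 0 < z.re → z ∈ Complex.slitPlane := fun z hz => Or.inl hz
  have hne : ∀ z : ℂ, 0 < z.re → z ≠ 0 := fun z hz => by rintro rfl; simp at hz
  have hd : ∀ z : ℂ, 0 < z.re → HasDerivAt (fun z => z ^ a * f z) 0 z := by
    intro z hz
    have h1 : HasDerivAt (fun z : ℂ => z ^ a) (a * z ^ (a - 1) * 1) z :=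
      (hasDerivAt_id z).cpow_const (hslit z hz)
    refine (h1.mul (cexp_sub_exp_deriv ha hz)).congr_deriv ?_
    have hp := cexp_sub_exp_parts ha hz
    have : z ^ a = z ^ (a - 1) * z := by
      rw [Complex.cpow_sub _ _ (hne z hz), Complex.cpow_one, div_mul_cancel₀ _ (hne z hz)]
    rw [this]
    linear_combination z ^ (a-1) * hp
  have hopen : IsOpen {z : ℂ | 0 < z.re} := isOpen_lt continuous_const Complex.continuous_re
  have hconv : Convex ℝ {z : ℂ | 0 < z.re} := convex_halfSpace_re_gt 0
  have hconst : r ^ a * f r = 1 ^ a * f 1 := by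
    refine hconv.is_const_of_fderivWithin_eq_zero (𝕜 := ℂ) (f := fun z => z ^ a * f z)
      (fun z hz => (hd z hz).differentiableAt.differentiableWithinAt) ?_ hr (by simp)
    intro z hz
    rw [fderivWithin_of_isOpen hopen hz]
    have := (hd z hz).hasFDerivAt.fderiv
    rw [this]
    ext; simp
  have h1 : f 1 = Complex.Gamma a := gamma_cexp_integral_one ha
  rw [h1, Complex.one_cpow, one_mul] at hconst
  rw [← hconst, ← mul_assoc, ← Complex.cpow_add _ _ (hne r hr)]
  simp [hf]

/-- Bessel function of integer order. -/
def Jb (n : ℤ) (z : ℝ) : ℝ := (1 / (2 * π)) * ∫ θ in (-π)..π, Real.cos (z * Real.sin θ - n * θ)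

lemma Jb_abs_le (n : ℤ) (z : ℝ) : |Jb n z| ≤ 1 := by
  unfold Jb
  have h : ‖∫ θ in (-π)..π, Real.cos (z * Real.sin θ - n * θ)‖ ≤ 1 * |π - -π| :=
    intervalIntegral.norm_integral_le_of_norm_le_const fun θ _ => Real.abs_cos_le_one _
  rw [Real.norm_eq_abs, abs_of_pos (a := π - -π) (by linarith [Real.pi_pos])] at h
  rw [abs_mul, abs_of_pos (by positivity)]
  calc _ ≤ 1 / (2 * π) * (1 * (π - -π)) := by gcongr
    _ = 1 := by field_simp; ring

lemma Jb_hasDerivAt (n : ℤ) (z : ℝ) :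
    HasDerivAt (Jb n) ((Jb (n - 1) z - Jb (n + 1) z) / 2) z := by
  have h := intervalIntegral.hasDerivAt_integral_of_dominated_loc_of_deriv_le (μ := volume)
    (a := -π) (b := π) (x₀ := z) (s := univ)
    (F := fun z θ => Real.cos (z * Real.sin θ - n * θ))
    (F' := fun z θ => -Real.sin (z * Real.sin θ - n * θ) * (1 * Real.sin θ)) (bound := fun _ => 1)
    Filter.univ_mem (Filter.Eventually.of_forall fun z => by fun_prop)
    (Continuous.intervalIntegrable (by fun_prop) _ _) (by fun_prop)
    (Filter.Eventually.of_forall fun θ _ z _ => by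
      rw [norm_mul, norm_neg, one_mul]
      calc _ ≤ (1:ℝ) * 1 := by
            gcongr
            · exact Real.abs_sin_le_one _
            · exact Real.abs_sin_le_one _
        _ = 1 := one_mul 1)
    (by simp)
    (Filter.Eventually.of_forall fun θ _ z _ =>
      (((hasDerivAt_id z).mul_const (Real.sin θ)).sub_const _).cos)
  refine (h.2.const_mul (1 / (2 * π))).congr_deriv ?_
  unfold Jb
  rw [← mul_sub, ← intervalIntegral.integral_sub (Continuous.intervalIntegrable (by fun_prop) _ _)
    (Continuous.intervalIntegrable (by fun_prop) _ _), mul_div_assoc, ← intervalIntegral.integral_div]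
  congr 1
  apply intervalIntegral.integral_congr
  intro θ _
  simp only
  push_cast
  rw [show z * Real.sin θ - ((n:ℝ) - 1) * θ = (z * Real.sin θ - n * θ) + θ by ring,
    show z * Real.sin θ - ((n:ℝ) + 1) * θ = (z * Real.sin θ - n * θ) - θ by ring,
    Real.cos_add (z * Real.sin θ - n * θ) θ, Real.cos_sub (z * Real.sin θ - n * θ) θ]
  ring

lemma Jb_continuous (n : ℤ) : Continuous (Jb n) :=
  continuous_iff_continuousAt.2 fun z => (Jb_hasDerivAt n z).continuousAt

lemma Jb_rec (n : ℤ) (z : ℝ) : z * (Jb (n - 1) z + Jb (n + 1) z) = 2 * n * Jb n z := by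
  have h : ∫ θ in (-π)..π, Real.cos (z * Real.sin θ - n * θ) * (z * Real.cos θ - n * 1) =
      Real.sin (z * Real.sin π - n * π) - Real.sin (z * Real.sin (-π) - n * (-π)) := by
    refine intervalIntegral.integral_eq_sub_of_hasDerivAt
      (f := fun θ => Real.sin (z * Real.sin θ - n * θ)) (fun θ _ => ?_)
      (Continuous.intervalIntegrable (by fun_prop) _ _)
    exact (((Real.hasDerivAt_sin θ).const_mul z).sub ((hasDerivAt_id θ).const_mul (n:ℝ))).sin
  have h0 : Real.sin (z * Real.sin π - n * π) - Real.sin (z * Real.sin (-π) - n * (-π)) = 0 := by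
    simp [Real.sin_int_mul_pi]
  rw [h0] at h
  unfold Jb
  rw [← mul_add, ← intervalIntegral.integral_add (Continuous.intervalIntegrable (by fun_prop) _ _)
    (Continuous.intervalIntegrable (by fun_prop) _ _)]
  have e : (∫ θ in (-π)..π, (Real.cos (z * Real.sin θ - (n - 1 : ℤ) * θ) +
      Real.cos (z * Real.sin θ - (n + 1 : ℤ) * θ))) =
      ∫ θ in (-π)..π, 2 * (Real.cos (z * Real.sin θ - n * θ) * Real.cos θ) := by
    apply intervalIntegral.integral_congr
    intro θ _
    simp only
    push_cast
    rw [show z * Real.sin θ - ((n:ℝ) - 1) * θ = (z * Real.sin θ - n * θ) + θ by ring,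
      show z * Real.sin θ - ((n:ℝ) + 1) * θ = (z * Real.sin θ - n * θ) - θ by ring,
      Real.cos_add (z * Real.sin θ - n * θ) θ, Real.cos_sub (z * Real.sin θ - n * θ) θ]
    ring
  have e2 : (∫ θ in (-π)..π, Real.cos (z * Real.sin θ - n * θ) * (z * Real.cos θ - n * 1)) =
      z * (∫ θ in (-π)..π, (Real.cos (z * Real.sin θ - n * θ) * Real.cos θ)) -
      n * ∫ θ in (-π)..π, Real.cos (z * Real.sin θ - n * θ) := by
    rw [← intervalIntegral.integral_const_mul, ← intervalIntegral.integral_const_mul,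
      ← intervalIntegral.integral_sub (Continuous.intervalIntegrable (by fun_prop) _ _)
        (Continuous.intervalIntegrable (by fun_prop) _ _)]
    apply intervalIntegral.integral_congr
    intro θ _
    simp only
    ring
  rw [e2] at h
  rw [e, intervalIntegral.integral_const_mul]
  linear_combination (1 / (2 * π)) * 2 * h

lemma Jb_complex (n : ℤ) (z : ℝ) : (Jb n z : ℂ) = (1 / (2 * π)) *
    ∫ θ in (-π)..π, Complex.exp (Complex.I * ((z * Real.sin θ - n * θ : ℝ) : ℂ)) := by
  have hodd : ∫ θ in (-π)..π, Real.sin (z * Real.sin θ - n * θ) = 0 := by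
    have h := intervalIntegral.integral_comp_neg (a := -π) (b := π)
      (fun θ => Real.sin (z * Real.sin θ - n * θ))
    have e : ∀ θ : ℝ, Real.sin (z * Real.sin (-θ) - n * (-θ)) =
        -Real.sin (z * Real.sin θ - n * θ) := by
      intro θ; rw [← Real.sin_neg, Real.sin_neg θ]; congr 1; ring
    simp only [e, neg_neg, intervalIntegral.integral_neg] at h
    linarith
  have e : ∀ θ : ℝ, Complex.exp (Complex.I * ((z * Real.sin θ - n * θ : ℝ) : ℂ)) =
      ((Real.cos (z * Real.sin θ - n * θ) : ℝ) : ℂ) +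
        Complex.I * ((Real.sin (z * Real.sin θ - n * θ) : ℝ) : ℂ) := by
    intro θ
    rw [mul_comm, Complex.exp_mul_I, Complex.ofReal_cos, Complex.ofReal_sin, mul_comm Complex.I]
  simp_rw [e]
  rw [intervalIntegral.integral_add (Continuous.intervalIntegrable (by fun_prop) _ _)
    (Continuous.intervalIntegrable (by fun_prop) _ _), intervalIntegral.integral_const_mul,
    intervalIntegral.integral_ofReal, intervalIntegral.integral_ofReal, hodd]
  unfold Jb
  push_cast
  ring

/-- decay of Bessel functions -/
lemma Jb_decay (n : ℕ) : ∃ C : ℝ, 0 < C ∧ ∀ z : ℝ, 0 < z → Jb n z ^ 2 ≤ C / z := by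
  set N : ℝ := 2 * n + 1 with hN
  have hN1 : 1 ≤ N := by rw [hN]; have : (0:ℝ) ≤ n := by positivity
                         linarith
  set G : ℝ → ℝ := fun z => z * (Jb n z ^ 2 + Jb (n + 1) z ^ 2) - N * (Jb n z * Jb (n + 1) z) with hG
  have hda : ∀ z : ℝ, z ≠ 0 → HasDerivAt (Jb n) (n / z * Jb n z - Jb (n + 1) z) z := by
    intro z hz
    refine (Jb_hasDerivAt n z).congr_deriv ?_
    have := Jb_rec n z
    push_cast at this
    field_simp
    linarith
  have hdb : ∀ z : ℝ, z ≠ 0 →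
      HasDerivAt (Jb (n + 1)) (Jb n z - (n + 1) / z * Jb (n + 1) z) z := by
    intro z hz
    refine (Jb_hasDerivAt (n+1) z).congr_deriv ?_
    have := Jb_rec (n+1) z
    push_cast at this
    rw [add_sub_cancel_right] at this ⊢
    field_simp
    linarith
  have hdG : ∀ z : ℝ, z ≠ 0 → HasDerivAt G (N * (Jb n z * Jb (n + 1) z) / z) z := by
    intro z hz
    have h := ((hasDerivAt_id z).mul (((hda z hz).pow 2).add ((hdb z hz).pow 2))).sub
      (((hda z hz).mul (hdb z hz)).const_mul N)
    refine h.congr_deriv ?_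
    simp only [id, hN, Pi.add_apply, Pi.pow_apply]
    field_simp
    push_cast
    ring
  have hGlow : ∀ z : ℝ, N ≤ z → z * (Jb n z ^ 2 + Jb (n + 1) z ^ 2) ≤ 2 * G z := by
    intro z hz
    simp only [hG]
    nlinarith [sq_nonneg (Jb n z - Jb (n+1) z), sq_nonneg (Jb n z), sq_nonneg (Jb (n+1) z),
      mul_nonneg (sub_nonneg.2 hz) (add_nonneg (sq_nonneg (Jb n z)) (sq_nonneg (Jb (n+1) z)))]
  have hanti : AntitoneOn (fun z => G z * Real.exp (N / z)) (Set.Ici N) := by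
    have hd : ∀ z : ℝ, z ≠ 0 → HasDerivAt (fun z => G z * Real.exp (N / z))
        (N * (Jb n z * Jb (n + 1) z) / z * Real.exp (N / z) +
          G z * (Real.exp (N / z) * (N * (-(z ^ 2)⁻¹)))) z := by
      intro z hz
      refine (hdG z hz).mul ?_
      have := ((hasDerivAt_inv hz).const_mul N).exp
      simpa [div_eq_mul_inv] using this
    refine antitoneOn_of_deriv_nonpos (convex_Ici N) ?_ ?_ ?_
    · intro z hz
      have : N ≤ z := hz
      exact (hd z (by linarith)).continuousAt.continuousWithinAt
    · intro z hz
      rw [interior_Ici] at hz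
      have : N < z := hz
      exact (hd z (by linarith)).differentiableAt.differentiableWithinAt
    · intro z hz
      rw [interior_Ici] at hz
      have hz' : N < z := hz
      have hz0 : 0 < z := by linarith
      rw [(hd z hz0.ne').deriv]
      have h1 := hGlow z hz'.le
      have e : N * (Jb n z * Jb (n + 1) z) / z * Real.exp (N / z) +
          G z * (Real.exp (N / z) * (N * (-(z ^ 2)⁻¹))) =
          (N * Real.exp (N / z) / z ^ 2) * (z * (Jb n z * Jb (n+1) z) - G z) := by
        field_simp
        ring
      rw [e]
      apply mul_nonpos_of_nonneg_of_nonpos (by positivity)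
      nlinarith [sq_nonneg (Jb n z - Jb (n+1) z)]
  have hM : ∀ z : ℝ, N ≤ z → G z ≤ G N * Real.exp (N / N) := by
    intro z hz
    have h := hanti (Set.mem_Ici.2 le_rfl) (Set.mem_Ici.2 hz) hz
    simp only at h
    have hz0 : 0 < z := by linarith
    have h0 : 0 ≤ G z := by
      have := hGlow z hz
      have h3 : 0 ≤ z * (Jb n z ^ 2 + Jb (n + 1) z ^ 2) := by positivity
      linarith
    have : 1 ≤ Real.exp (N / z) := Real.one_le_exp (by positivity)
    nlinarith
  have hM0 : 0 ≤ G N * Real.exp (N / N) := by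
    have := hGlow N le_rfl
    have h3 : 0 ≤ N * (Jb n N ^ 2 + Jb (n + 1) N ^ 2) := by positivity
    have : 0 ≤ G N := by linarith
    positivity
  refine ⟨N + 2 * (G N * Real.exp (N / N)), by positivity, fun z hz => ?_⟩
  rw [le_div_iff₀ hz]
  by_cases hzN : z ≤ N
  · have h1 : Jb n z ^ 2 ≤ 1 := by
      rw [← sq_abs]; have := Jb_abs_le n z; have := abs_nonneg (Jb n z); nlinarith
    nlinarith [sq_nonneg (Jb n z)]
  · push Not at hzN
    have h1 := hGlow z hzN.le
    have h2 := hM z hzN.le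
    have h3 : 0 ≤ z * Jb (n+1) z ^ 2 := by positivity
    nlinarith

lemma integrable_exp_neg_mul_abs' {c : ℝ} (hc : 0 < c) :
    Integrable (fun p : ℝ => Real.exp (-c * |p|)) := by
  rw [← integrableOn_univ, ← Set.Iic_union_Ioi (a := (0:ℝ))]
  refine IntegrableOn.union ?_ ?_
  · refine (integrableOn_exp_mul_Iic hc 0).congr_fun (fun p hp => ?_) measurableSet_Iic
    have : p ≤ 0 := hp
    simp only [abs_of_nonpos this]; congr 1; ring
  · refine (integrableOn_exp_mul_Ioi (neg_neg_iff_pos.2 hc) 0).congr_fun (fun p hp => ?_)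
      measurableSet_Ioi
    have : 0 < p := hp
    simp only [abs_of_pos this]

lemma Jb_exp_bound (n : ℕ) {x : ℝ} (hx : 0 < x) (hx2 : x < 1 / 2) :
    ∃ C : ℝ, 0 < C ∧ ∃ c : ℝ, 0 < c ∧ ∀ p : ℝ,
      Real.exp (x * p) * |Jb n (Real.exp p)| ≤ C * Real.exp (-c * |p|) := by
  obtain ⟨C, hC, h⟩ := Jb_decay n
  refine ⟨1 + √C, by positivity, min x (1 / 2 - x), lt_min hx (by linarith), fun p => ?_⟩
  have hm1 := min_le_left x (1 / 2 - x)
  have hm2 := min_le_right x (1 / 2 - x)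
  set m := min x (1 / 2 - x)
  rcases le_total p 0 with hp | hp
  · calc Real.exp (x * p) * |Jb n (Real.exp p)| ≤ Real.exp (x * p) * 1 := by
          gcongr; exact Jb_abs_le _ _
      _ ≤ 1 * Real.exp (-m * |p|) := by
          rw [mul_one, one_mul, abs_of_nonpos hp]; apply Real.exp_le_exp.2; nlinarith
      _ ≤ _ := by gcongr; linarith [Real.sqrt_nonneg C]
  · have h1 : |Jb n (Real.exp p)| ≤ √C * Real.exp (-p / 2) := by
      apply abs_le_of_sq_le_sq _ (by positivity)
      rw [mul_pow, Real.sq_sqrt hC.le, ← Real.exp_nat_mul]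
      refine (h _ (Real.exp_pos p)).trans (le_of_eq ?_)
      rw [div_eq_mul_inv, ← Real.exp_neg]
      congr 2; push_cast; ring
    calc Real.exp (x * p) * |Jb n (Real.exp p)| ≤ Real.exp (x * p) * (√C * Real.exp (-p / 2)) := by
          gcongr
      _ = √C * Real.exp (x * p - p / 2) := by
          rw [sub_eq_add_neg, Real.exp_add]; ring_nf
      _ ≤ √C * Real.exp (-m * |p|) := by
          rw [abs_of_nonneg hp]; gcongr ?_ * ?_; apply Real.exp_le_exp.2; nlinarith
      _ ≤ _ := by gcongr; linarith

lemma Jb_mellin_integrable (n : ℕ) {w : ℂ} (hx : 0 < w.re) (hx2 : w.re < 1 / 2) :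
    Integrable (fun p : ℝ => Complex.exp (w * p) * (Jb n (Real.exp p) : ℂ)) := by
  obtain ⟨C, hC, c, hc, h⟩ := Jb_exp_bound n hx hx2
  have hcont : Continuous (fun p : ℝ => Complex.exp (w * p) * (Jb n (Real.exp p) : ℂ)) := by
    have := (Jb_continuous n).comp Real.continuous_exp
    simp only [Function.comp_def] at this
    fun_prop
  refine ((integrable_exp_neg_mul_abs' hc).const_mul C).mono' hcont.aestronglyMeasurable ?_
  refine Filter.Eventually.of_forall fun p => ?_
  rw [norm_mul, Complex.norm_exp, Complex.norm_real, Real.norm_eq_abs, Complex.re_mul_ofReal]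
  exact h p

/-- The Mellin transform of the Bessel function (in exponential coordinates). -/
def MJ (n : ℕ) (w : ℂ) : ℂ := ∫ p : ℝ, Complex.exp (w * p) * (Jb n (Real.exp p) : ℂ)

lemma MJ_rec (n : ℕ) {w : ℂ} (hx : 0 < w.re) (hx2 : w.re < 1 / 2) :
    ((n:ℂ) + 2 - w) * MJ (n + 2) w = (n + w) * MJ n w := by
  have i0 := Jb_mellin_integrable n hx hx2
  have i2 := Jb_mellin_integrable (n + 2) hx hx2
  have hJ : ∀ (m : ℕ) (p : ℝ), HasDerivAt (fun p : ℝ => (Jb m (Real.exp p) : ℂ))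
      ((((Jb (m - 1) (Real.exp p) - Jb (m + 1) (Real.exp p)) / 2 * Real.exp p : ℝ)) : ℂ) p := by
    intro m p
    exact ((Jb_hasDerivAt m (Real.exp p)).comp p (Real.hasDerivAt_exp p)).ofReal_comp
  have hE : ∀ p : ℝ, HasDerivAt (fun p : ℝ => Complex.exp (w * p)) (Complex.exp (w * p) * (w * 1)) p :=
    fun p => (((hasDerivAt_id p).ofReal_comp).const_mul w).cexp
  have e : ∀ p : ℝ, HasDerivAt (fun p : ℝ => Complex.exp (w * p) * (Jb n (Real.exp p) : ℂ) +
      Complex.exp (w * p) * (Jb (n + 2 : ℕ) (Real.exp p) : ℂ))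
      ((n + w) * (Complex.exp (w * p) * (Jb n (Real.exp p) : ℂ)) -
        ((n:ℂ) + 2 - w) * (Complex.exp (w * p) * (Jb (n + 2 : ℕ) (Real.exp p) : ℂ))) p := by
    intro p
    refine (((hE p).mul (hJ n p)).add ((hE p).mul (hJ (n+2) p))).congr_deriv ?_
    have r0 := Jb_rec n (Real.exp p)
    have r2 := Jb_rec (n + 2 : ℕ) (Real.exp p)
    have a1 : ((n + 2 : ℕ) : ℤ) - 1 = n + 1 := by push_cast; ring
    rw [a1] at r2 ⊢
    have key : (Jb (n - 1) (Real.exp p) - Jb (n + 1) (Real.exp p)) / 2 * Real.exp p +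
        (Jb (n + 1) (Real.exp p) - Jb ((n + 2 : ℕ) + 1) (Real.exp p)) / 2 * Real.exp p =
        n * Jb n (Real.exp p) - (n + 2) * Jb (n + 2 : ℕ) (Real.exp p) := by
      push_cast at r0 r2 ⊢
      linarith
    have keyC := congrArg (fun x : ℝ => (x : ℂ)) key
    push_cast at keyC ⊢
    linear_combination Complex.exp (w * p) * keyC
  have h := integral_eq_zero_of_hasDerivAt_of_integrable e
    ((i0.const_mul _).sub (i2.const_mul _)) (i0.add i2)
  rw [integral_sub (i0.const_mul _) (i2.const_mul _), integral_const_mul, integral_const_mul] at h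
  exact (sub_eq_zero.1 h).symm

lemma integral_quarter {f : ℝ → ℝ} (hf : Continuous f) (he : ∀ θ, f (-θ) = f θ)
    (hp : ∀ θ, f (π - θ) = f θ) :
    ∫ θ in (-π)..π, f θ = 4 * ∫ θ in (0:ℝ)..(π/2), f θ := by
  have i : ∀ a b, IntervalIntegrable f volume a b := fun a b => hf.intervalIntegrable a b
  have h1 : ∫ θ in (-π)..0, f θ = ∫ θ in (0:ℝ)..π, f θ := by
    have := intervalIntegral.integral_comp_neg (a := -π) (b := 0) f
    simpa [he] using this
  have h2 : ∫ θ in (π/2)..π, f θ = ∫ θ in (0:ℝ)..(π/2), f θ := by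
    have := intervalIntegral.integral_comp_sub_left (a := π/2) (b := π) f π
    simp only [hp] at this
    rw [this]; congr 1 <;> ring
  rw [← intervalIntegral.integral_add_adjacent_intervals (i (-π) 0) (i 0 π), h1,
    ← intervalIntegral.integral_add_adjacent_intervals (i 0 (π/2)) (i (π/2) π), h2]
  ring

lemma Jb_zero_eq (z : ℝ) : Jb (0:ℕ) z = (2 / π) * ∫ θ in (0:ℝ)..(π/2), Real.cos (z * Real.sin θ) := by
  unfold Jb
  simp only [Nat.cast_zero, Int.cast_zero, zero_mul, sub_zero]
  rw [integral_quarter (by fun_prop) (by intro θ; simp) (by intro θ; simp)]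
  field_simp
  ring

lemma Jb_one_eq {z : ℝ} (hz : z ≠ 0) : Jb (1:ℕ) z =
    (2 / π) * ∫ θ in (0:ℝ)..(π/2), Real.sin (z * Real.sin θ) * Real.sin θ := by
  have h0 : Jb (-1) z + Jb 1 z = 0 := by
    have := Jb_rec 0 z
    simpa [hz] using this
  have h1 : Jb (1:ℕ) z = (Jb 1 z - Jb (-1) z) / 2 := by
    push_cast; linarith
  rw [h1]
  unfold Jb
  rw [← mul_sub, ← intervalIntegral.integral_sub (Continuous.intervalIntegrable (by fun_prop) _ _)
    (Continuous.intervalIntegrable (by fun_prop) _ _)]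
  have e : (∫ θ in (-π)..π, (Real.cos (z * Real.sin θ - (1 : ℤ) * θ) -
      Real.cos (z * Real.sin θ - (-1 : ℤ) * θ))) =
      ∫ θ in (-π)..π, 2 * (Real.sin (z * Real.sin θ) * Real.sin θ) := by
    apply intervalIntegral.integral_congr
    intro θ _
    simp only
    push_cast
    rw [one_mul, neg_one_mul, sub_neg_eq_add, Real.cos_add, Real.cos_sub]
    ring
  rw [e, intervalIntegral.integral_const_mul,
    integral_quarter (by fun_prop) (by intro θ; simp) (by intro θ; simp)]
  field_simp
  ring

lemma norm_cpow_neg_le {r : ℂ} (h0 : r ≠ 0) (w : ℂ) :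
    ‖r ^ (-w)‖ ≤ ‖r‖ ^ (-w.re) * Real.exp (|Complex.arg r| * |w.im|) := by
  rw [Complex.norm_cpow_of_ne_zero h0, div_eq_mul_inv, ← Real.exp_neg, Complex.neg_re,
    Complex.neg_im]
  gcongr
  calc -(Complex.arg r * -w.im) = Complex.arg r * w.im := by ring
    _ ≤ |Complex.arg r * w.im| := le_abs_self _
    _ = _ := abs_mul _ _

lemma sin_sq_image : (fun θ : ℝ => Real.sin θ ^ 2) '' Ioo 0 (π / 2) = Ioo (0:ℝ) 1 := by
  ext x
  constructor
  · rintro ⟨θ, ⟨h1, h2⟩, rfl⟩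
    have hs : 0 < Real.sin θ := Real.sin_pos_of_pos_of_lt_pi h1 (by linarith)
    have hc : 0 < Real.cos θ := Real.cos_pos_of_mem_Ioo ⟨by linarith, h2⟩
    have := Real.sin_sq_add_cos_sq θ
    exact ⟨by positivity, by nlinarith⟩
  · rintro ⟨h1, h2⟩
    have hs : 0 < √x := Real.sqrt_pos.2 h1
    have hs1 : √x < 1 := by rw [Real.sqrt_lt' one_pos]; simpa using h2
    refine ⟨Real.arcsin √x, ⟨Real.arcsin_pos.2 hs, Real.arcsin_lt_pi_div_two.2 hs1⟩, ?_⟩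
    simp only
    rw [Real.sin_arcsin (by linarith) hs1.le, Real.sq_sqrt h1.le]

lemma integral_sin_cpow (u : ℂ) :
    ∫ θ in (0:ℝ)..(π/2), (Real.sin θ : ℂ) ^ (2 * u - 1) = Complex.betaIntegral u (1 / 2) / 2 := by
  have hd : ∀ θ ∈ Ioo 0 (π / 2), HasDerivWithinAt (fun θ : ℝ => Real.sin θ ^ 2)
      (2 * Real.sin θ * Real.cos θ) (Ioo 0 (π/2)) θ := by
    intro θ _
    have := ((Real.hasDerivAt_sin θ).pow 2).hasDerivWithinAt (s := Ioo 0 (π/2))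
    refine this.congr_deriv ?_
    simp
  have hinj : InjOn (fun θ : ℝ => Real.sin θ ^ 2) (Ioo 0 (π / 2)) := by
    intro a ha b hb hab
    have hsa : 0 < Real.sin a := Real.sin_pos_of_pos_of_lt_pi ha.1 (by linarith [Real.pi_pos, ha.2])
    have hsb : 0 < Real.sin b := Real.sin_pos_of_pos_of_lt_pi hb.1 (by linarith [Real.pi_pos, hb.2])
    have : Real.sin a = Real.sin b := by
      have := abs_eq_abs.2 (sq_eq_sq_iff_eq_or_eq_neg.1 hab)
      rwa [abs_of_pos hsa, abs_of_pos hsb] at this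
    exact Real.injOn_sin ⟨by linarith [Real.pi_pos, ha.1], ha.2.le⟩ ⟨by linarith [Real.pi_pos, hb.1], hb.2.le⟩ this
  rw [Complex.betaIntegral, intervalIntegral.integral_of_le zero_le_one,
    integral_Ioc_eq_integral_Ioo, ← sin_sq_image,
    integral_image_eq_integral_abs_deriv_smul measurableSet_Ioo hd hinj,
    intervalIntegral.integral_of_le (by positivity), integral_Ioc_eq_integral_Ioo,
    ← integral_div]
  refine setIntegral_congr_fun measurableSet_Ioo fun θ hθ => ?_
  have hs : 0 < Real.sin θ := Real.sin_pos_of_pos_of_lt_pi hθ.1 (by linarith [Real.pi_pos, hθ.2])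
  have hc : 0 < Real.cos θ := Real.cos_pos_of_mem_Ioo ⟨by linarith [Real.pi_pos, hθ.1], hθ.2⟩
  rw [abs_of_pos (by positivity), Complex.real_smul]
  have e1 : (1 - ((Real.sin θ ^ 2 : ℝ) : ℂ)) = ((Real.cos θ ^ 2 : ℝ) : ℂ) := by
    rw [Real.sin_sq]; push_cast; ring
  have e2 : ((Real.cos θ ^ 2 : ℝ) : ℂ) ^ ((1 / 2 : ℂ) - 1) = ((Real.cos θ)⁻¹ : ℝ) := by
    rw [show ((1 / 2 : ℂ) - 1) = ((-(1/2) : ℝ) : ℂ) by push_cast; ring, ← Complex.ofReal_cpow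
      (by positivity), ← Real.rpow_natCast, ← Real.rpow_mul hc.le]
    norm_num
    rw [Real.rpow_neg_one]; simp
  have hsC : (Real.sin θ : ℂ) ≠ 0 := by exact_mod_cast hs.ne'
  have e3 : ((Real.sin θ ^ 2 : ℝ) : ℂ) ^ (u - 1) = (Real.sin θ : ℂ) ^ (2 * u - 2) := by
    rw [show 2 * u - 2 = ((2:ℕ):ℂ) * (u - 1) by push_cast; ring, Complex.ofReal_pow]
    rw [Complex.cpow_nat_mul' (by rw [Complex.arg_ofReal_of_nonneg hs.le]; simp [Real.pi_pos])
      (by rw [Complex.arg_ofReal_of_nonneg hs.le]; simp [Real.pi_pos.le])]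
  rw [e1, e2, e3, show 2 * u - 1 = (2 * u - 2) + 1 by ring, Complex.cpow_add _ _ hsC, Complex.cpow_one]
  have hcC : (Real.cos θ : ℂ) ≠ 0 := by exact_mod_cast hc.ne'
  rw [Complex.ofReal_inv, Complex.ofReal_mul, Complex.ofReal_mul, Complex.ofReal_ofNat]
  field_simp

lemma mellin_osc_reg {w : ℂ} (hw : 0 < w.re) {δ : ℝ} (hδ : 0 < δ) (e : ℝ) {φ : ℝ → ℝ}
    (hφ : Continuous φ) :
    ∫ p : ℝ, Complex.exp (w * p - δ * (Real.exp p : ℝ)) *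
      (∫ θ in (0:ℝ)..(π/2), Complex.exp (Complex.I * e * (Real.exp p : ℝ) * (Real.sin θ : ℝ)) * φ θ) =
    Complex.Gamma w * ∫ θ in (0:ℝ)..(π/2), (δ - Complex.I * e * (Real.sin θ : ℝ)) ^ (-w) * φ θ := by
  set f : ℝ → ℝ → ℂ := fun θ p => Complex.exp (w * p - (δ - Complex.I * e * (Real.sin θ : ℝ)) *
    (Real.exp p : ℝ)) * φ θ with hf
  have hre : ∀ θ : ℝ, ((δ:ℂ) - Complex.I * e * (Real.sin θ : ℝ)).re = δ := by
    intro θ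
    simp [Complex.sub_re, mul_assoc, Complex.mul_re, ← Complex.ofReal_mul, -Complex.ofReal_sin]
  have h1 : ∀ p : ℝ, Complex.exp (w * p - δ * (Real.exp p : ℝ)) *
      (∫ θ in (0:ℝ)..(π/2), Complex.exp (Complex.I * e * (Real.exp p : ℝ) * (Real.sin θ : ℝ)) * φ θ) =
      ∫ θ in (0:ℝ)..(π/2), f θ p := by
    intro p
    rw [← intervalIntegral.integral_const_mul]
    congr 1; ext θ
    simp only [hf]
    rw [← mul_assoc, ← Complex.exp_add]
    congr 2; ring
  have h2 : ∀ θ : ℝ, ∫ p : ℝ, f θ p = Complex.Gamma w *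
      ((δ - Complex.I * e * (Real.sin θ : ℝ)) ^ (-w) * φ θ) := by
    intro θ
    simp only [hf]
    rw [integral_mul_const, gamma_cexp_integral hw (by rw [hre]; exact hδ)]
    ring
  simp_rw [h1]
  rw [← intervalIntegral_integral_swap]
  · simp_rw [h2]
    rw [intervalIntegral.integral_const_mul]
  · have i1 : Integrable (fun θ : ℝ => |φ θ|) (volume.restrict (Set.uIoc 0 (π/2))) := by
      have := (hφ.abs.intervalIntegrable (μ := volume) 0 (π/2))
      exact (intervalIntegrable_iff.1 this)
    have i2 := integrable_exp_sub_exp (x := w.re) (r := δ) hw hδ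
    refine (i1.mul_prod i2).mono' ?_ ?_
    · apply Continuous.aestronglyMeasurable
      simp only [hf, Function.uncurry_def]
      fun_prop
    · refine Filter.Eventually.of_forall fun x => ?_
      simp only [hf, Function.uncurry_def]
      rw [norm_mul, norm_cexp_sub_exp, hre, Complex.norm_real, Real.norm_eq_abs, mul_comm]

lemma neg_I_mul_cpow {e v : ℝ} (he : e = 1 ∨ e = -1) (hv : 0 < v) (w : ℂ) :
    (0 - Complex.I * e * (v:ℂ)) ^ (-w) =
      Complex.exp (Complex.I * e * (π * w / 2)) * (v:ℂ) ^ (-w) := by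
  have hv0 : (v:ℂ) ≠ 0 := by exact_mod_cast hv.ne'
  have hlog : Complex.log (0 - Complex.I * e * (v:ℂ)) = Real.log v - Complex.I * e * (π / 2) := by
    rcases he with rfl | rfl
    · rw [show (0 - Complex.I * ((1:ℝ):ℂ) * (v:ℂ)) = (v:ℂ) * (-Complex.I) by push_cast; ring,
        Complex.log_ofReal_mul hv (by simp), Complex.log_neg_I]
      push_cast; ring
    · rw [show (0 - Complex.I * ((-1:ℝ):ℂ) * (v:ℂ)) = (v:ℂ) * (Complex.I) by push_cast; ring,
        Complex.log_ofReal_mul hv (by simp), Complex.log_I]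
      push_cast; ring
  have hne : (0 - Complex.I * e * (v:ℂ)) ≠ 0 := by
    rcases he with rfl | rfl <;> simp [hv0]
  rw [Complex.cpow_def_of_ne_zero hne, hlog, Complex.cpow_def_of_ne_zero hv0, ← Complex.exp_add,
    ← Complex.ofReal_log hv.le]
  congr 1; ring

lemma mellin_osc_limit {w : ℂ} (hw : 0 < w.re) (hw2 : w.re < 1) {e : ℝ} (he : e = 1 ∨ e = -1)
    {φ : ℝ → ℝ} (hφ : Continuous φ) :
    Filter.Tendsto (fun δ : ℝ =>
      ∫ θ in (0:ℝ)..(π/2), ((δ:ℂ) - Complex.I * e * (Real.sin θ : ℝ)) ^ (-w) * φ θ)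
      (nhdsWithin 0 (Set.Ioi 0))
      (nhds (Complex.exp (Complex.I * e * (π * w / 2)) *
        ∫ θ in (0:ℝ)..(π/2), (Real.sin θ : ℂ) ^ (-w) * φ θ)) := by
  have hpi := Real.pi_pos
  obtain ⟨M, hM⟩ := (isCompact_Icc (a := (0:ℝ)) (b := π/2)).exists_bound_of_continuousOn
    hφ.continuousOn
  have hpos : ∀ θ ∈ Set.Ioc (0:ℝ) (π/2), 0 < Real.sin θ := fun θ hθ =>
    Real.sin_pos_of_pos_of_lt_pi hθ.1 (by linarith [hθ.2])
  have hcr : ∀ (δ : ℝ) (v : ℝ), ‖(δ:ℂ) - Complex.I * e * (v:ℝ)‖ ^ 2 = δ ^ 2 + v ^ 2 := by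
    intro δ v
    rw [← Complex.normSq_eq_norm_sq, Complex.normSq_apply]
    rcases he with rfl | rfl <;> simp <;> ring
  rw [← intervalIntegral.integral_const_mul]
  refine intervalIntegral.tendsto_integral_filter_of_dominated_convergence
    (fun θ => (2 / π) ^ (-w.re) * Real.exp (π / 2 * |w.im|) * M * θ ^ (-w.re)) ?_ ?_ ?_ ?_
  · filter_upwards [self_mem_nhdsWithin] with δ hδ
    have hδ : 0 < δ := hδ
    apply Continuous.aestronglyMeasurable
    refine Continuous.mul ?_ (by fun_prop)
    refine Continuous.cpow (by fun_prop) continuous_const fun θ => Or.inl ?_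
    rcases he with rfl | rfl <;> simp [-Complex.ofReal_sin, hδ]
  · filter_upwards [self_mem_nhdsWithin] with δ hδ
    have hδ : 0 < δ := hδ
    refine Filter.Eventually.of_forall fun θ hθ => ?_
    rw [Set.uIoc_of_le (by positivity)] at hθ
    have hs := hpos θ hθ
    have hlow : 2 / π * θ ≤ Real.sin θ := Real.mul_le_sin hθ.1.le hθ.2
    set r : ℂ := (δ:ℂ) - Complex.I * e * (Real.sin θ : ℝ) with hr
    have hrre : r.re = δ := by
      rw [hr]; rcases he with rfl | rfl <;> simp [-Complex.ofReal_sin]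
    have hr0 : r ≠ 0 := by intro h; rw [h] at hrre; simp at hrre; linarith
    have hrn : Real.sin θ ≤ ‖r‖ := by
      apply le_of_sq_le_sq _ (norm_nonneg _)
      rw [hcr]; nlinarith
    have harg : |Complex.arg r| ≤ π / 2 := by
      rw [Complex.abs_arg_le_pi_div_two_iff, hrre]; exact hδ.le
    rw [norm_mul]
    calc ‖r ^ (-w)‖ * ‖((φ θ : ℝ) : ℂ)‖
        ≤ (‖r‖ ^ (-w.re) * Real.exp (|Complex.arg r| * |w.im|)) * M := by
          gcongr
          · exact norm_cpow_neg_le hr0 w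
          · rw [Complex.norm_real]; exact hM θ ⟨hθ.1.le, hθ.2⟩
      _ ≤ ((2 / π * θ) ^ (-w.re) * Real.exp (π / 2 * |w.im|)) * M := by
          have hM0 : 0 ≤ M := (norm_nonneg _).trans (hM θ ⟨hθ.1.le, hθ.2⟩)
          have hθ0 := hθ.1
          gcongr ?_ * Real.exp (?_ * _) * _
          exact Real.rpow_le_rpow_of_nonpos (by positivity) (hlow.trans hrn) (by linarith)
      _ = _ := by rw [Real.mul_rpow (by positivity) hθ.1.le]; ring
  · exact (intervalIntegral.intervalIntegrable_rpow' (by linarith)).const_mul _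
  · refine Filter.Eventually.of_forall fun θ hθ => ?_
    rw [Set.uIoc_of_le (by positivity)] at hθ
    have hs := hpos θ hθ
    rw [← mul_assoc, ← neg_I_mul_cpow he hs]
    refine Filter.Tendsto.mono_left ?_ nhdsWithin_le_nhds
    refine Filter.Tendsto.mul ?_ tendsto_const_nhds
    have hc : ContinuousAt (fun δ : ℝ => ((δ:ℂ) - Complex.I * e * (Real.sin θ : ℝ)) ^ (-w)) 0 := by
      refine ContinuousAt.cpow (by fun_prop) continuousAt_const (Or.inr ?_)
      rcases he with rfl | rfl <;> simp [-Complex.ofReal_sin, hs.ne']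
    have := hc.tendsto
    simpa [-Complex.ofReal_sin] using this

def Aosc (φ : ℝ → ℝ) (e : ℝ) (p : ℝ) : ℂ :=
  ∫ θ in (0:ℝ)..(π/2), Complex.exp (Complex.I * e * (Real.exp p : ℝ) * (Real.sin θ : ℝ)) * φ θ

lemma Aosc_reg_integrable {φ : ℝ → ℝ} (hφ : Continuous φ) (e : ℝ) {w : ℂ} (hw : 0 < w.re) {δ : ℝ}
    (hδ : 0 < δ) :
    Integrable (fun p : ℝ => Complex.exp (w * p - δ * (Real.exp p : ℝ)) * Aosc φ e p) := by
  have hpi := Real.pi_pos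
  obtain ⟨M, hM⟩ := (isCompact_Icc (a := (0:ℝ)) (b := π/2)).exists_bound_of_continuousOn
    hφ.continuousOn
  have hc : Continuous (Aosc φ e) := by
    unfold Aosc
    apply intervalIntegral.continuous_parametric_intervalIntegral_of_continuous'
    simp only [Function.uncurry_def]
    fun_prop
  refine (integrable_cexp_sub_exp (a := w) (r := δ) hw (by simpa using hδ)).mul_bdd
    (c := M * |π / 2 - 0|) hc.aestronglyMeasurable (Filter.Eventually.of_forall fun p => ?_)
  apply intervalIntegral.norm_integral_le_of_norm_le_const
  intro θ hθ
  rw [Set.uIoc_of_le (by positivity)] at hθ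
  rw [norm_mul, show Complex.I * e * (Real.exp p : ℝ) * (Real.sin θ : ℝ) =
    ((e * Real.exp p * Real.sin θ : ℝ) : ℂ) * Complex.I by push_cast; ring,
    Complex.norm_exp_ofReal_mul_I, one_mul, Complex.norm_real]
  exact hM θ ⟨hθ.1.le, hθ.2⟩

lemma MJ_of_osc (n : ℕ) {φ : ℝ → ℝ} (hφ : Continuous φ) (c1 c2 : ℂ)
    (hJ : ∀ p : ℝ, (Jb n (Real.exp p) : ℂ) = c1 * Aosc φ 1 p + c2 * Aosc φ (-1) p)
    {w : ℂ} (hw : 0 < w.re) (hw2 : w.re < 1 / 2) :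
    MJ n w = Complex.Gamma w * (c1 * Complex.exp (Complex.I * (π * w / 2)) +
      c2 * Complex.exp (-(Complex.I * (π * w / 2)))) *
      ∫ θ in (0:ℝ)..(π/2), (Real.sin θ : ℂ) ^ (-w) * φ θ := by
  have hL : Filter.Tendsto (fun δ : ℝ => ∫ p : ℝ, Complex.exp (w * p - δ * (Real.exp p : ℝ)) *
      (Jb n (Real.exp p) : ℂ)) (nhdsWithin 0 (Set.Ioi 0)) (nhds (MJ n w)) := by
    have hJc := (Jb_continuous n).comp Real.continuous_exp
    simp only [Function.comp_def] at hJc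
    refine tendsto_integral_filter_of_dominated_convergence
      (fun p => ‖Complex.exp (w * p) * (Jb n (Real.exp p) : ℂ)‖) ?_ ?_ ?_ ?_
    · refine Filter.Eventually.of_forall fun δ => Continuous.aestronglyMeasurable (by fun_prop)
    · filter_upwards [self_mem_nhdsWithin] with δ hδ
      have hδ : 0 < δ := hδ
      refine Filter.Eventually.of_forall fun p => ?_
      rw [norm_mul, norm_mul, norm_cexp_sub_exp, Complex.norm_exp, Complex.re_mul_ofReal]
      gcongr
      simp only [Complex.ofReal_re]
      have := Real.exp_pos p
      nlinarith
    · exact (Jb_mellin_integrable n hw hw2).norm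
    · refine Filter.Eventually.of_forall fun p => ?_
      refine Filter.Tendsto.mono_left ?_ nhdsWithin_le_nhds
      have hc : Continuous (fun δ : ℝ => Complex.exp (w * p - δ * (Real.exp p : ℝ)) *
        (Jb n (Real.exp p) : ℂ)) := by fun_prop
      have := hc.tendsto 0
      simpa using this
  have hR := (((mellin_osc_limit hw (by linarith) (e := 1) (Or.inl rfl) hφ).const_mul
      (c1 * Complex.Gamma w)).add
    ((mellin_osc_limit hw (by linarith) (e := -1) (Or.inr rfl) hφ).const_mul (c2 * Complex.Gamma w)))
  have heq : (fun δ : ℝ => ∫ p : ℝ, Complex.exp (w * p - δ * (Real.exp p : ℝ)) *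
      (Jb n (Real.exp p) : ℂ)) =ᶠ[nhdsWithin 0 (Set.Ioi 0)] (fun δ : ℝ => 
      c1 * Complex.Gamma w *
      (∫ θ in (0:ℝ)..(π/2), ((δ:ℂ) - Complex.I * (1:ℝ) * (Real.sin θ : ℝ)) ^ (-w) * φ θ) +
      c2 * Complex.Gamma w *
      ∫ θ in (0:ℝ)..(π/2), ((δ:ℂ) - Complex.I * (-1:ℝ) * (Real.sin θ : ℝ)) ^ (-w) * φ θ) := by
    filter_upwards [self_mem_nhdsWithin] with δ hδ
    have hδ : 0 < δ := hδ
    have i1 := Aosc_reg_integrable hφ 1 hw hδ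
    have i2 := Aosc_reg_integrable hφ (-1) hw hδ
    rw [mul_assoc c1, mul_assoc c2, ← mellin_osc_reg hw hδ 1 hφ, ← mellin_osc_reg hw hδ (-1) hφ]
    have : ∀ p : ℝ, Complex.exp (w * p - δ * (Real.exp p : ℝ)) * (Jb n (Real.exp p) : ℂ) =
        c1 * (Complex.exp (w * p - δ * (Real.exp p : ℝ)) * Aosc φ 1 p) +
        c2 * (Complex.exp (w * p - δ * (Real.exp p : ℝ)) * Aosc φ (-1) p) := by
      intro p; rw [hJ]; ring
    simp_rw [this]
    rw [integral_add (i1.const_mul c1) (i2.const_mul c2), integral_const_mul, integral_const_mul]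
    rfl
  have := tendsto_nhds_unique (hL.congr' heq) hR
  rw [this]
  push_cast
  rw [mul_one, mul_neg_one, neg_mul]
  ring

lemma cos_eq_osc (z : ℝ) : (Real.cos z : ℂ) =
    1 / 2 * Complex.exp (Complex.I * z) + 1 / 2 * Complex.exp (-(Complex.I * z)) := by
  rw [Complex.ofReal_cos, Complex.cos]; rw [mul_comm Complex.I, neg_mul]; ring

lemma sin_eq_osc (z : ℝ) : (Real.sin z : ℂ) =
    -Complex.I / 2 * Complex.exp (Complex.I * z) + Complex.I / 2 * Complex.exp (-(Complex.I * z)) := by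
  rw [Complex.ofReal_sin, Complex.sin]; rw [mul_comm Complex.I (z:ℂ), neg_mul]; ring

lemma Jb_zero_osc (p : ℝ) : (Jb (0:ℕ) (Real.exp p) : ℂ) =
    (1 / π) * Aosc (fun _ => 1) 1 p + (1 / π) * Aosc (fun _ => 1) (-1) p := by
  rw [Jb_zero_eq, ← mul_add, Aosc, Aosc, ← intervalIntegral.integral_add
    (Continuous.intervalIntegrable (by fun_prop) _ _)
    (Continuous.intervalIntegrable (by fun_prop) _ _), Complex.ofReal_mul,
    ← intervalIntegral.integral_ofReal]
  rw [show (((2 / π : ℝ)) : ℂ) = (1 / π) * 2 by push_cast; ring, mul_assoc,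
    ← intervalIntegral.integral_const_mul]
  congr 2; ext θ
  rw [cos_eq_osc]
  push_cast
  ring_nf

lemma Jb_one_osc (p : ℝ) : (Jb (1:ℕ) (Real.exp p) : ℂ) =
    (-Complex.I / π) * Aosc Real.sin 1 p + (Complex.I / π) * Aosc Real.sin (-1) p := by
  rw [Jb_one_eq (Real.exp_pos p).ne', Aosc, Aosc,
    ← intervalIntegral.integral_const_mul (-Complex.I / π),
    ← intervalIntegral.integral_const_mul (Complex.I / π), ← intervalIntegral.integral_add
    (Continuous.intervalIntegrable (by fun_prop) _ _)
    (Continuous.intervalIntegrable (by fun_prop) _ _), Complex.ofReal_mul,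
    ← intervalIntegral.integral_ofReal, ← intervalIntegral.integral_const_mul]
  congr 1; ext θ
  rw [Complex.ofReal_mul, sin_eq_osc (Real.exp p * Real.sin θ)]
  push_cast
  ring_nf

/-- closed form -/
def MJv (n : ℕ) (w : ℂ) : ℂ :=
  2 ^ (w - 1) * Complex.Gamma ((n + w) / 2) / Complex.Gamma ((n - w) / 2 + 1)

lemma gamma_dup (w : ℂ) : Complex.Gamma w =
    Complex.Gamma (w / 2) * Complex.Gamma ((1 + w) / 2) * 2 ^ (w - 1) / (√π : ℝ) := by
  have h := Complex.Gamma_mul_Gamma_add_half (w / 2)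
  rw [show w / 2 + 1 / 2 = (1 + w) / 2 by ring, show 2 * (w / 2) = w by ring] at h
  have h2 : (2:ℂ) ^ (1 - w) * 2 ^ (w - 1) = 1 := by
    rw [← Complex.cpow_add _ _ two_ne_zero]; simp
  have hpi : ((√π : ℝ) : ℂ) ≠ 0 := by
    have := Real.sqrt_pos.2 Real.pi_pos; exact_mod_cast this.ne'
  rw [h, eq_div_iff hpi]
  linear_combination (-Complex.Gamma w * (√π : ℝ)) * h2

lemma MJ_zero {w : ℂ} (hw : 0 < w.re) (hw2 : w.re < 1 / 2) : MJ 0 w = MJv 0 w := by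
  rw [MJ_of_osc 0 continuous_const _ _ Jb_zero_osc hw hw2]
  have e1 : (∫ θ in (0:ℝ)..(π/2), (Real.sin θ : ℂ) ^ (-w) * ((1:ℝ):ℂ)) =
      Complex.betaIntegral ((1 - w) / 2) (1 / 2) / 2 := by
    rw [← integral_sin_cpow]
    congr 1; ext θ
    rw [Complex.ofReal_one, mul_one]; congr 1; ring
  rw [e1, Complex.betaIntegral_eq_Gamma_mul_div _ _ (by simp; linarith) (by norm_num),
    Complex.Gamma_one_half_eq, gamma_dup w, MJv]
  have hpi : ((√π : ℝ) : ℂ) ≠ 0 := by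
    have := Real.sqrt_pos.2 Real.pi_pos; exact_mod_cast this.ne'
  have hpi2 : (π : ℂ) ≠ 0 := by exact_mod_cast Real.pi_ne_zero
  have hsq : ((π:ℂ)) ^ (1 / 2 : ℂ) = ((√π : ℝ) : ℂ) := by
    rw [Real.sqrt_eq_rpow, Complex.ofReal_cpow Real.pi_pos.le]; norm_num
  have hrefl := Complex.Gamma_mul_Gamma_one_sub ((1 + w) / 2)
  rw [show 1 - (1 + w) / 2 = (1 - w) / 2 by ring,
    show π * ((1 + w) / 2) = π * w / 2 + π / 2 by ring, Complex.sin_add_pi_div_two] at hrefl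
  have hcos : Complex.cos (π * w / 2) ≠ 0 := by
    intro h0
    rw [h0, div_zero] at hrefl
    rcases mul_eq_zero.1 hrefl with h | h
    · exact Complex.Gamma_ne_zero_of_re_pos (by simp; linarith) h
    · exact Complex.Gamma_ne_zero_of_re_pos (by simp; linarith) h
  have hc : 1 / (π:ℂ) * Complex.exp (Complex.I * (π * w / 2)) +
      1 / π * Complex.exp (-(Complex.I * (π * w / 2))) = 2 / π * Complex.cos (π * w / 2) := by
    rw [Complex.cos, mul_comm Complex.I, neg_mul]; ring
  rw [hc, hsq]
  have hG : Complex.Gamma (1 - w / 2) ≠ 0 :=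
    Complex.Gamma_ne_zero_of_re_pos (by simp; linarith)
  rw [show (1 - w) / 2 + 1 / 2 = 1 - w / 2 by ring, Nat.cast_zero, zero_add,
    show (0 - w) / 2 + 1 = 1 - w / 2 by ring]
  rw [eq_div_iff hcos] at hrefl
  clear hc hsq hcos e1
  revert hrefl hG
  generalize Complex.Gamma (1 - w / 2) = g1
  generalize Complex.Gamma ((1 - w) / 2) = g2
  generalize Complex.Gamma ((1 + w) / 2) = g3
  generalize Complex.Gamma (w / 2) = g4
  generalize Complex.cos (π * w / 2) = cc
  generalize (2:ℂ) ^ (w - 1) = pp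
  intro hrefl hG
  field_simp
  linear_combination g4 * pp * hrefl

lemma MJ_one {w : ℂ} (hw : 0 < w.re) (hw2 : w.re < 1 / 2) : MJ 1 w = MJv 1 w := by
  rw [MJ_of_osc 1 Real.continuous_sin _ _ Jb_one_osc hw hw2]
  have hpi0 := Real.pi_pos
  have e1 : (∫ θ in (0:ℝ)..(π/2), (Real.sin θ : ℂ) ^ (-w) * (Real.sin θ : ℂ)) =
      Complex.betaIntegral (1 - w / 2) (1 / 2) / 2 := by
    rw [← integral_sin_cpow, intervalIntegral.integral_of_le (by positivity),
      intervalIntegral.integral_of_le (by positivity)]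
    refine setIntegral_congr_fun measurableSet_Ioc fun θ hθ => ?_
    have hs : 0 < Real.sin θ := Real.sin_pos_of_pos_of_lt_pi hθ.1 (by linarith [hθ.2])
    have hsC : (Real.sin θ : ℂ) ≠ 0 := by exact_mod_cast hs.ne'
    rw [show 2 * (1 - w / 2) - 1 = -w + 1 by ring, Complex.cpow_add _ _ hsC, Complex.cpow_one]
  rw [e1, Complex.betaIntegral_eq_Gamma_mul_div _ _ (by simp; linarith) (by norm_num),
    Complex.Gamma_one_half_eq, gamma_dup w, MJv]
  have hpi : ((√π : ℝ) : ℂ) ≠ 0 := by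
    have := Real.sqrt_pos.2 Real.pi_pos; exact_mod_cast this.ne'
  have hpi2 : (π : ℂ) ≠ 0 := by exact_mod_cast Real.pi_ne_zero
  have hsq : ((π:ℂ)) ^ (1 / 2 : ℂ) = ((√π : ℝ) : ℂ) := by
    rw [Real.sqrt_eq_rpow, Complex.ofReal_cpow Real.pi_pos.le]; norm_num
  have hrefl := Complex.Gamma_mul_Gamma_one_sub (w / 2)
  rw [show π * (w / 2) = π * w / 2 by ring] at hrefl
  have hcos : Complex.sin (π * w / 2) ≠ 0 := by
    intro h0
    rw [h0, div_zero] at hrefl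
    rcases mul_eq_zero.1 hrefl with h | h
    · exact Complex.Gamma_ne_zero_of_re_pos (by simp; linarith) h
    · exact Complex.Gamma_ne_zero_of_re_pos (by simp; linarith) h
  have hc : -Complex.I / (π:ℂ) * Complex.exp (Complex.I * (π * w / 2)) +
      Complex.I / π * Complex.exp (-(Complex.I * (π * w / 2))) = 2 / π * Complex.sin (π * w / 2) := by
    rw [Complex.sin, mul_comm Complex.I (π * w / 2), neg_mul]; ring
  rw [hc, hsq]
  have hG : Complex.Gamma ((1 - w) / 2 + 1) ≠ 0 :=
    Complex.Gamma_ne_zero_of_re_pos (by simp; linarith)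
  rw [show 1 - w / 2 + 1 / 2 = (1 - w) / 2 + 1 by ring, Nat.cast_one]
  rw [eq_div_iff hcos] at hrefl
  clear hc hsq hcos e1
  revert hrefl hG
  generalize Complex.Gamma ((1 - w) / 2 + 1) = g1
  generalize Complex.Gamma (1 - w / 2) = g2
  generalize Complex.Gamma ((1 + w) / 2) = g3
  generalize Complex.Gamma (w / 2) = g4
  generalize Complex.sin (π * w / 2) = cc
  generalize (2:ℂ) ^ (w - 1) = pp
  intro hrefl hG
  field_simp
  linear_combination g3 * pp * hrefl

lemma MJ_eq (n : ℕ) {w : ℂ} (hw : 0 < w.re) (hw2 : w.re < 1 / 2) : MJ n w = MJv n w := by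
  have step : ∀ n : ℕ, MJ n w = MJv n w → MJ (n + 2) w = MJv (n + 2) w := by
    intro n ih
    have hr := MJ_rec n hw hw2
    rw [ih] at hr
    have hn : (0:ℝ) ≤ n := by positivity
    have hne : ((n:ℂ) + 2 - w) ≠ 0 := by
      intro h; have := congrArg Complex.re h; simp at this; linarith
    have hne2 : ((n:ℂ) + w) / 2 ≠ 0 := by
      intro h; have := congrArg Complex.re h; simp at this; linarith
    have hne3 : ((n:ℂ) - w) / 2 + 1 ≠ 0 := by
      intro h; have := congrArg Complex.re h; simp at this; linarith
    apply mul_left_cancel₀ hne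
    rw [hr, MJv, MJv]
    push_cast
    rw [show ((n:ℂ) + 2 + w) / 2 = (n + w) / 2 + 1 by ring,
      show ((n:ℂ) + 2 - w) / 2 + 1 = ((n - w) / 2 + 1) + 1 by ring,
      Complex.Gamma_add_one _ hne2, Complex.Gamma_add_one _ hne3]
    have hG : Complex.Gamma (((n:ℂ) - w) / 2 + 1) ≠ 0 :=
      Complex.Gamma_ne_zero_of_re_pos (by simp; linarith)
    have : ((n:ℂ) + 2 - w) = 2 * (((n:ℂ) - w) / 2 + 1) := by ring
    rw [this]
    clear this hr ih hne hne2
    revert hG hne3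
    generalize Complex.Gamma (((n:ℂ) - w) / 2 + 1) = g1
    generalize ((n:ℂ) - w) / 2 + 1 = x
    generalize Complex.Gamma (((n:ℂ) + w) / 2) = g2
    intro hne3 hG
    field_simp
  induction n using Nat.twoStepInduction with
  | zero => exact MJ_zero hw hw2
  | one => exact MJ_one hw hw2
  | more n ih _ => exact step n ih

/-- The weighted Bessel function whose Fourier transform is `Q`. -/
def fQ (n : ℕ) (q : ℝ) : ℂ := Complex.exp ((1 / 12 : ℂ) * q) * (Jb n (2 * Real.exp (q / 2)) : ℂ)

lemma two_exp_half (q : ℝ) : 2 * Real.exp (q / 2) = Real.exp (q / 2 + Real.log 2) := by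
  rw [Real.exp_add, Real.exp_log two_pos, mul_comm]

lemma fQ_integrable (n : ℕ) : Integrable (fQ n) := by
  have h := Jb_mellin_integrable n (w := 1 / 6) (by norm_num) (by norm_num)
  have h2 := (h.comp_add_right (Real.log 2)).comp_mul_left' (R := 1 / 2) (by norm_num)
  have h3 := h2.const_mul (Complex.exp (-(1 / 6 * Real.log 2)))
  refine h3.congr (Filter.Eventually.of_forall fun q => ?_)
  simp only [fQ]
  rw [two_exp_half, ← mul_assoc, ← Complex.exp_add]
  congr 2
  · push_cast; ring
  · ring_nf

lemma Q_eq_fourier {d : ℕ} (hd : 2 ≤ d) (τ : ℝ) :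
    Qfun d ((1 / 12 : ℂ) + τ * Complex.I) =
      ∫ q : ℝ, Complex.exp (Complex.I * τ * q) * fQ (d - 1) q := by
  have h := MJ_eq (d - 1) (w := 2 * ((1 / 12 : ℂ) + τ * Complex.I)) (by simp) (by simp; norm_num)
  rw [MJ, MJv] at h
  have hcast : ((d - 1 : ℕ) : ℂ) = (d : ℂ) - 1 := by
    rw [Nat.cast_sub (by omega)]; simp
  have e1 := Measure.integral_comp_mul_left (fun p : ℝ =>
    Complex.exp (2 * ((1 / 12 : ℂ) + τ * Complex.I) *
    ((p + Real.log 2 : ℝ) : ℂ)) * (Jb (d - 1 : ℕ) (Real.exp (p + Real.log 2)) : ℂ)) (1 / 2 : ℝ)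
  rw [integral_add_right_eq_self (fun p : ℝ => Complex.exp (2 * ((1 / 12 : ℂ) + τ * Complex.I) *
    (p : ℂ)) * (Jb (d - 1 : ℕ) (Real.exp p) : ℂ)), h] at e1
  have h2 : (2:ℂ) ^ (2 * ((1 / 12 : ℂ) + τ * Complex.I) - 1) =
      Complex.exp (2 * ((1 / 12 : ℂ) + τ * Complex.I) * Real.log 2) / 2 := by
    rw [Complex.cpow_sub _ _ two_ne_zero, Complex.cpow_one,
      Complex.cpow_def_of_ne_zero two_ne_zero, Complex.ofReal_log (by norm_num), mul_comm]
    simp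
  have e2 : ∀ q : ℝ, Complex.exp (2 * ((1 / 12 : ℂ) + τ * Complex.I) *
      ((1 / 2 * q + Real.log 2 : ℝ) : ℂ)) * (Jb (d - 1 : ℕ) (Real.exp (1 / 2 * q + Real.log 2)) : ℂ)
      = Complex.exp (2 * ((1 / 12 : ℂ) + τ * Complex.I) * Real.log 2) *
        (Complex.exp (Complex.I * τ * q) * fQ (d - 1) q) := by
    intro q
    rw [fQ, two_exp_half, ← mul_assoc, ← mul_assoc, ← Complex.exp_add, ← Complex.exp_add]
    congr 2
    · push_cast; ring
    · ring_nf
  simp only [e2] at e1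
  rw [integral_const_mul, h2, hcast] at e1
  have hE := Complex.exp_ne_zero (2 * ((1 / 12 : ℂ) + τ * Complex.I) * Real.log 2)
  apply mul_left_cancel₀ hE
  rw [e1, Qfun, show ((d:ℂ) - 1 + 2 * (1 / 12 + τ * Complex.I)) / 2 =
    (d - 1) / 2 + (1 / 12 + τ * Complex.I) by ring,
    show ((d:ℂ) - 1 - 2 * (1 / 12 + τ * Complex.I)) / 2 + 1 =
    (d + 1) / 2 - (1 / 12 + τ * Complex.I) by ring]
  rw [show |((1 / 2 : ℝ))⁻¹| = 2 by norm_num, Complex.real_smul]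
  push_cast
  ring

open FourierTransform in
lemma fourier_inv_raw {g : ℝ → ℂ} (hgc : Continuous g) (hg : Integrable g)
    (hg2 : Integrable (fun τ : ℝ => ∫ p : ℝ, Complex.exp (Complex.I * τ * p) * g p)) (x : ℝ) :
    ∫ τ : ℝ, Complex.exp (-(Complex.I * τ * x)) * ∫ p : ℝ, Complex.exp (Complex.I * τ * p) * g p
      = 2 * π * g x := by
  have hpi := Real.pi_pos
  have hF : ∀ ξ : ℝ, 𝓕 g ξ = ∫ p : ℝ, Complex.exp (Complex.I * ((-2 * π * ξ : ℝ) : ℂ) * p) * g p := by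
    intro ξ
    rw [Real.fourier_eq']
    congr 1; ext p
    simp only [RCLike.inner_apply, conj_trivial, smul_eq_mul]
    congr 2; push_cast; ring
  have hFi : Integrable (𝓕 g) := by
    have := hg2.comp_mul_left' (R := -2 * π) (by positivity)
    refine this.congr (Filter.Eventually.of_forall fun ξ => ?_)
    exact (hF ξ).symm
  have h := congrFun (hgc.fourierInv_fourier_eq hg hFi) x
  rw [Real.fourierInv_eq'] at h
  have e1 := Measure.integral_comp_mul_left (fun τ : ℝ => Complex.exp (-(Complex.I * τ * x)) *
    ∫ p : ℝ, Complex.exp (Complex.I * τ * p) * g p) (-2 * π)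
  have e2 : ∀ ξ : ℝ, Complex.exp (-(Complex.I * ((-2 * π * ξ : ℝ) : ℂ) * x)) *
    ∫ p : ℝ, Complex.exp (Complex.I * ((-2 * π * ξ : ℝ) : ℂ) * p) * g p =
      Complex.exp ((2 * π * inner ℝ ξ x : ℝ) * Complex.I) • 𝓕 g ξ := by
    intro ξ
    rw [hF]
    simp only [RCLike.inner_apply, conj_trivial, smul_eq_mul]
    congr 2; push_cast; ring
  simp only [e2] at e1
  rw [h] at e1
  rw [e1, show |(-2 * π)⁻¹| = (2 * π)⁻¹ by
    rw [abs_inv, abs_of_neg (by linarith)]; ring, Complex.real_smul]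
  have : (2 * π:ℂ) ≠ 0 := by
    have : (π:ℂ) ≠ 0 := by exact_mod_cast hpi.ne'
    simpa using this
  push_cast
  rw [mul_inv_cancel_left₀ this]

lemma parseval_raw {f g : ℝ → ℂ} (hf : Integrable f) (hgc : Continuous g) (hg : Integrable g)
    (hg2 : Integrable (fun τ : ℝ => ∫ p : ℝ, Complex.exp (Complex.I * τ * p) * g p)) (L : ℝ) :
    ∫ τ : ℝ, (∫ q : ℝ, Complex.exp (Complex.I * τ * q) * f q) * (Complex.exp (-(Complex.I * τ * L)) *
      ∫ p : ℝ, Complex.exp (Complex.I * τ * p) * g p) = 2 * π * ∫ q : ℝ, f q * g (L - q) := by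
  set G : ℝ → ℂ := fun τ : ℝ => ∫ p : ℝ, Complex.exp (Complex.I * τ * p) * g p with hG
  have hIntg : Integrable (Function.uncurry fun (τ q : ℝ) =>
      Complex.exp (Complex.I * τ * (q - L)) * (G τ * f q)) (volume.prod volume) := by
    have := hg2.mul_prod hf
    refine this.bdd_mul (c := 1) (Continuous.aestronglyMeasurable (by fun_prop)) 
      (Filter.Eventually.of_forall fun x => ?_)
    rw [show Complex.I * (x.1:ℂ) * (x.2 - L) = ((x.1 * (x.2 - L) : ℝ) : ℂ) * Complex.I by
      push_cast; ring, Complex.norm_exp_ofReal_mul_I]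
  calc _ = ∫ τ : ℝ, ∫ q : ℝ, Complex.exp (Complex.I * τ * (q - L)) * (G τ * f q) := by
        congr 1; ext τ
        rw [← integral_mul_const]
        congr 1; ext q
        rw [show Complex.I * (τ:ℂ) * (q - L) = Complex.I * τ * q + -(Complex.I * τ * L) by ring,
          Complex.exp_add]
        ring
    _ = ∫ q : ℝ, ∫ τ : ℝ, Complex.exp (Complex.I * τ * (q - L)) * (G τ * f q) :=
        integral_integral_swap hIntg
    _ = ∫ q : ℝ, 2 * π * (f q * g (L - q)) := by
        congr 1; ext q
        rw [show 2 * (π:ℂ) * (f q * g (L - q)) = f q * (2 * π * g (L - q)) by ring,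
          ← fourier_inv_raw hgc hg hg2, ← integral_const_mul]
        congr 1; ext τ
        rw [show Complex.I * (τ:ℂ) * (q - L) = -(Complex.I * τ * ((L - q : ℝ) : ℂ)) by
          push_cast; ring]
        ring
    _ = _ := integral_const_mul _ _

lemma gamma_twelfth : ∃ C : ℝ, 0 < C ∧ ∀ u : ℝ, ‖Complex.Gamma ((1 / 12 : ℂ) + u * Complex.I)‖ ≤
    C * (1 + |u|) ^ (-(5 / 12) : ℝ) * Real.exp (-(π * |u| / 2)) := by
  obtain ⟨C, hC, h⟩ := gamma_ratio_decay (x := 1 / 12) (l := 5 / 12) (by norm_num) (by norm_num)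
    (by norm_num)
  refine ⟨C * √(2 * π), by positivity, fun u => ?_⟩
  have h1 := h u
  have h2 := gamma_half_line u
  rw [show (((1 / 12 : ℝ) : ℂ) + ((5 / 12 : ℝ) : ℂ) + u * Complex.I) = 1 / 2 + u * Complex.I by
    push_cast; ring] at h1
  rw [show (((1 / 12 : ℝ) : ℂ)) = 1 / 12 by push_cast; ring] at h1
  calc _ ≤ _ := h1
    _ ≤ C * (1 + |u|) ^ (-(5 / 12) : ℝ) * (√(2 * π) * Real.exp (-(π * |u| / 2))) := by gcongr
    _ = _ := by ring

lemma one_le_norm_reg {e : ℝ} (he : e = 1 ∨ e = -1) (δ : ℝ) : 1 ≤ ‖(δ:ℂ) - Complex.I * e‖ := by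
  have h := Complex.abs_im_le_norm ((δ:ℂ) - Complex.I * e)
  rcases he with rfl | rfl <;> simpa using h

lemma reg_ne {e : ℝ} (he : e = 1 ∨ e = -1) (δ : ℝ) : (δ:ℂ) - Complex.I * e ≠ 0 := by
  intro h
  have := one_le_norm_reg he δ
  rw [h, norm_zero] at this
  linarith

/-- the regularised factor -/
def Rg (e δ u : ℝ) : ℂ := ((δ:ℂ) - Complex.I * e) ^ (-((1 / 12 : ℂ) + u * Complex.I)) *
  Complex.Gamma ((1 / 12 : ℂ) + u * Complex.I)

lemma Rg_bound : ∃ C : ℝ, 0 < C ∧ ∀ e : ℝ, (e = 1 ∨ e = -1) → ∀ δ u : ℝ, 0 ≤ δ →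
    ‖Rg e δ u‖ ≤ C * (1 + |u|) ^ (-(5 / 12) : ℝ) *
      Real.exp (-((π / 2 - |Complex.arg ((δ:ℂ) - Complex.I * e)|) * |u|)) := by
  obtain ⟨C, hC, h⟩ := gamma_twelfth
  refine ⟨C, hC, fun e he δ u hδ => ?_⟩
  rw [Rg, norm_mul]
  have h1 := norm_cpow_neg_le (reg_ne he δ) ((1 / 12 : ℂ) + u * Complex.I)
  have h2 : ‖(δ:ℂ) - Complex.I * e‖ ^ (-((1 / 12 : ℂ) + u * Complex.I).re) ≤ 1 :=
    Real.rpow_le_one_of_one_le_of_nonpos (one_le_norm_reg he δ) (by simp)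
  have h3 : ((1 / 12 : ℂ) + u * Complex.I).im = u := by simp
  rw [h3] at h1
  set a := |Complex.arg ((δ:ℂ) - Complex.I * e)|
  calc _ ≤ (1 * Real.exp (a * |u|)) * (C * (1 + |u|) ^ (-(5 / 12) : ℝ) * Real.exp (-(π * |u| / 2))) := by
        gcongr
        · exact h1.trans (by gcongr)
        · exact h u
    _ = C * (1 + |u|) ^ (-(5 / 12) : ℝ) * (Real.exp (a * |u|) * Real.exp (-(π * |u| / 2))) := by ring
    _ = _ := by
        rw [← Real.exp_add]; congr 2; ring

lemma arg_reg_le {e δ : ℝ} (hδ : 0 ≤ δ) :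
    |Complex.arg ((δ:ℂ) - Complex.I * e)| ≤ π / 2 := by
  rw [Complex.abs_arg_le_pi_div_two_iff]; simpa using hδ

lemma arg_reg_lt {e δ : ℝ} (hδ : 0 < δ) :
    |Complex.arg ((δ:ℂ) - Complex.I * e)| < π / 2 := by
  rw [Complex.abs_arg_lt_pi_div_two_iff]; left; simpa using hδ

lemma Rg_continuous {e δ : ℝ} (he : e = 1 ∨ e = -1) : Continuous (Rg e δ) := by
  unfold Rg
  have hne := reg_ne he δ
  refine Continuous.mul ?_ ?_
  · simp only [Complex.cpow_def_of_ne_zero hne]; fun_prop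
  · rw [continuous_iff_continuousAt]
    intro u
    have : ContinuousAt Complex.Gamma ((1 / 12 : ℂ) + u * Complex.I) := by
      refine (Complex.differentiableAt_Gamma _ fun m h => ?_).continuousAt
      have := congrArg Complex.re h
      simp at this
      have : (0:ℝ) ≤ m := by positivity
      linarith
    exact ContinuousAt.comp this (f := fun u : ℝ => (1 / 12 : ℂ) + u * Complex.I)
      (Continuous.continuousAt (by fun_prop))

lemma Rg_integrable {e δ : ℝ} (he : e = 1 ∨ e = -1) (hδ : 0 < δ) : Integrable (Rg e δ) := by
  obtain ⟨C, hC, h⟩ := Rg_bound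
  have := (integrable_exp_neg_mul_abs' (c := π / 2 - |Complex.arg ((δ:ℂ) - Complex.I * e)|)
    (by linarith [arg_reg_lt (e := e) hδ])).const_mul C
  refine this.mono' (Rg_continuous he).aestronglyMeasurable (Filter.Eventually.of_forall fun u => ?_)
  refine (h e he δ u hδ.le).trans ?_
  have h1 : (1 + |u|) ^ (-(5 / 12) : ℝ) ≤ 1 :=
    Real.rpow_le_one_of_one_le_of_nonpos (by linarith [abs_nonneg u]) (by norm_num)
  rw [← neg_mul]
  gcongr
  exact mul_le_of_le_one_right hC.le h1

lemma Rg_zero {e : ℝ} (he : e = 1 ∨ e = -1) (u : ℝ) : Rg e 0 u =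
    Complex.exp (e * Complex.I * π * ((1 / 12 : ℂ) + u * Complex.I) / 2) *
    Complex.Gamma ((1 / 12 : ℂ) + u * Complex.I) := by
  have := neg_I_mul_cpow he (v := 1) one_pos ((1 / 12 : ℂ) + u * Complex.I)
  rw [Rg]
  simp only [Complex.ofReal_one, mul_one, Complex.one_cpow] at this
  rw [Complex.ofReal_zero, this]
  congr 2; ring

lemma Rg_tendsto {e : ℝ} (he : e = 1 ∨ e = -1) (u : ℝ) :
    Filter.Tendsto (fun δ : ℝ => Rg e δ u) (nhdsWithin 0 (Set.Ioi 0)) (nhds (Rg e 0 u)) := by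
  refine Filter.Tendsto.mono_left ?_ nhdsWithin_le_nhds
  unfold Rg
  refine Filter.Tendsto.mul_const _ ?_
  have hs : ((0:ℝ):ℂ) - Complex.I * e ∈ Complex.slitPlane := by
    right; rcases he with rfl | rfl <;> simp
  have h1 : ContinuousAt (fun z : ℂ => z ^ (-((1 / 12 : ℂ) + u * Complex.I))) (((0:ℝ):ℂ) - Complex.I * e) :=
    continuousAt_id.cpow continuousAt_const hs
  exact ContinuousAt.comp h1 (f := fun δ : ℝ => (δ:ℂ) - Complex.I * e)
    (Continuous.continuousAt (by fun_prop))

/-- regularised identity for fixed t -/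
lemma reg_identity {d : ℕ} (hd : 2 ≤ d) {e δ : ℝ} (he : e = 1 ∨ e = -1) (hδ : 0 < δ) (t L : ℝ) :
    ∫ τ : ℝ, Qfun d ((1 / 12 : ℂ) + τ * Complex.I) * Complex.exp (-(((1 / 12 : ℂ) + τ * Complex.I) * L))
      * Rg e δ (τ + 3 * t) = 2 * π * ∫ p : ℝ, Complex.exp (3 * t * p * Complex.I) *
        (Complex.exp (-(((δ:ℂ) - Complex.I * e) * (Real.exp p : ℝ))) *
         (Jb (d - 1 : ℕ) (2 * Real.exp ((L - p) / 2)) : ℂ)) := by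
  set r := (δ:ℂ) - Complex.I * e with hr
  have hrre : 0 < r.re := by simpa [hr] using hδ
  set b : ℂ := 1 / 12 + 3 * t * Complex.I with hb
  have hbre : 0 < b.re := by simp [hb]
  have hgh : ∀ τ : ℝ, ∫ p : ℝ, Complex.exp (Complex.I * τ * p) * Complex.exp (b * p - r * (Real.exp p : ℝ))
      = Rg e δ (τ + 3 * t) := by
    intro τ
    have := gamma_cexp_integral (a := (1 / 12 : ℂ) + ((τ + 3 * t : ℝ):ℂ) * Complex.I) (r := r)
      (by simp) hrre
    rw [Rg, ← this]
    congr 1; ext p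
    rw [← Complex.exp_add]; congr 1; rw [hb]; push_cast; ring
  have hP := parseval_raw (f := fQ (d - 1)) (g := fun p : ℝ => Complex.exp (b * p - r * (Real.exp p : ℝ)))
    (fQ_integrable _) (by fun_prop) (integrable_cexp_sub_exp hbre hrre) (by
      simp_rw [hgh]
      exact (Rg_integrable he hδ).comp_add_right (3 * t)) L
  simp_rw [hgh] at hP
  have hsw := integral_sub_left_eq_self (fun q : ℝ => fQ (d - 1) q *
    Complex.exp (b * ((L - q : ℝ) : ℂ) - r * (Real.exp (L - q) : ℝ))) volume L
  simp only [← Q_eq_fourier hd] at hP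
  rw [← hsw] at hP
  have hE := Complex.exp_ne_zero ((L:ℂ) / 12)
  apply mul_left_cancel₀ hE
  rw [← integral_const_mul]
  rw [show Complex.exp ((L:ℂ) / 12) * (2 * π * ∫ p : ℝ, Complex.exp (3 * t * p * Complex.I) *
        (Complex.exp (-(r * (Real.exp p : ℝ))) *
         (Jb (d - 1 : ℕ) (2 * Real.exp ((L - p) / 2)) : ℂ))) = 2 * π * ∫ p : ℝ,
           Complex.exp ((L:ℂ) / 12) * (Complex.exp (3 * t * p * Complex.I) *
        (Complex.exp (-(r * (Real.exp p : ℝ))) *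
         (Jb (d - 1 : ℕ) (2 * Real.exp ((L - p) / 2)) : ℂ))) by
      rw [integral_const_mul]; ring]
  refine Eq.trans ?_ (hP.trans ?_)
  · refine integral_congr_ae (ae_of_all _ fun τ => ?_)
    beta_reduce
    rw [show -((1 / 12 + (τ:ℂ) * Complex.I) * L) = -(L:ℂ) / 12 + -(Complex.I * τ * L) by ring,
      Complex.exp_add]
    have : Complex.exp ((L:ℂ) / 12) * Complex.exp (-(L:ℂ) / 12) = 1 := by
      rw [← Complex.exp_add, ← Complex.exp_zero]; congr 1; ring
    linear_combination (Qfun d (1 / 12 + ↑τ * Complex.I) * Complex.exp (-(Complex.I * τ * L)) *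
      Rg e δ (τ + 3 * t)) * this
  · congr 1
    refine integral_congr_ae (ae_of_all _ fun p => ?_)
    beta_reduce
    rw [fQ, sub_sub_cancel]
    have : Complex.exp ((1 / 12 : ℂ) * ((L - p : ℝ) : ℂ)) * Complex.exp (b * p - r * (Real.exp p : ℝ)) =
      Complex.exp ((L:ℂ) / 12) * (Complex.exp (3 * t * p * Complex.I) * 
        Complex.exp (-(r * (Real.exp p : ℝ)))) := by
      rw [← Complex.exp_add, ← Complex.exp_add, ← Complex.exp_add]
      congr 1; rw [hb]; push_cast; ring
    linear_combination (Jb (d - 1 : ℕ) (2 * Real.exp ((L - p) / 2)) : ℂ) * this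

lemma Gamma_line_continuous {x : ℝ} (hx : 0 < x) (c : ℝ) :
    Continuous (fun τ : ℝ => Complex.Gamma ((x:ℂ) + c * τ * Complex.I)) := by
  rw [continuous_iff_continuousAt]
  intro u
  have : ContinuousAt Complex.Gamma ((x : ℂ) + c * u * Complex.I) := by
    refine (Complex.differentiableAt_Gamma _ fun m h => ?_).continuousAt
    have := congrArg Complex.re h
    simp at this
    have : (0:ℝ) ≤ m := by positivity
    linarith
  exact ContinuousAt.comp this (f := fun u : ℝ => (x : ℂ) + c * u * Complex.I)
    (Continuous.continuousAt (by fun_prop))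

lemma Q_den_ne {d : ℕ} (hd : 2 ≤ d) (τ : ℝ) :
    Complex.Gamma (((d : ℂ) + 1) / 2 - ((1 / 12 : ℂ) + τ * Complex.I)) ≠ 0 := by
  apply Complex.Gamma_ne_zero_of_re_pos
  have : (2:ℝ) ≤ d := by exact_mod_cast hd
  simp
  linarith

lemma Q_continuous {d : ℕ} (hd : 2 ≤ d) :
    Continuous (fun τ : ℝ => Qfun d ((1 / 12 : ℂ) + τ * Complex.I)) := by
  have h2 : (2:ℝ) ≤ d := by exact_mod_cast hd
  unfold Qfun
  refine Continuous.div₀ ?_ ?_ (Q_den_ne hd)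
  · refine (Gamma_line_continuous (x := (d - 1) / 2 + 1 / 12) (by linarith) 1).congr fun τ => ?_
    congr 1; push_cast; ring
  · refine (Gamma_line_continuous (x := (d + 1) / 2 - 1 / 12) (by linarith) (-1)).congr fun τ => ?_
    congr 1; push_cast; ring

lemma Q_bound {d : ℕ} (hd : 2 ≤ d) : ∃ C : ℝ, 0 < C ∧ ∀ τ : ℝ,
    ‖Qfun d ((1 / 12 : ℂ) + τ * Complex.I)‖ ≤ C * (1 + |τ|) ^ (-(5 / 6) : ℝ) := by
  have h2 : (2:ℝ) ≤ d := by exact_mod_cast hd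
  obtain ⟨C, hC, h⟩ := gamma_ratio_decay (x := (d - 1) / 2 + 1 / 12) (l := 5 / 6) (by linarith)
    (by norm_num) (by norm_num)
  refine ⟨C, hC, fun τ => ?_⟩
  have h1 := h τ
  have e1 : ((((d:ℝ) - 1) / 2 + 1 / 12 : ℝ) : ℂ) + τ * Complex.I =
      ((d:ℂ) - 1) / 2 + (1 / 12 + τ * Complex.I) := by push_cast; ring
  have e2 : ((((d:ℝ) - 1) / 2 + 1 / 12 : ℝ) : ℂ) + ((5 / 6 : ℝ) : ℂ) + τ * Complex.I =
      (starRingEnd ℂ) (((d:ℂ) + 1) / 2 - (1 / 12 + τ * Complex.I)) := by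
    rw [show ((d:ℂ) + 1) / 2 - (1 / 12 + τ * Complex.I) =
      ((((d:ℝ) + 1) / 2 - 1 / 12 : ℝ) : ℂ) + ((-τ : ℝ) : ℂ) * Complex.I by push_cast; ring,
      map_add, map_mul, Complex.conj_ofReal, Complex.conj_ofReal, Complex.conj_I]
    push_cast; ring
  rw [e1, e2, Complex.Gamma_conj, Complex.norm_conj] at h1
  rw [Qfun, norm_div, div_le_iff₀ (norm_pos_iff.2 (Q_den_ne hd τ))]
  exact h1

lemma exp_lin_bdd {δ : ℝ} (hδ : 0 < δ) : ∃ M : ℝ, ∀ p : ℝ,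
    Real.exp (1 / 12 * p - δ * Real.exp p) ≤ M := by
  set c := Real.log (1 / (12 * δ)) with hc
  have hec : δ * Real.exp c = 1 / 12 := by
    rw [hc, Real.exp_log (by positivity)]; field_simp
  refine ⟨Real.exp (c / 12), fun p => Real.exp_le_exp.2 ?_⟩
  have h1 : p - c ≤ Real.exp (p - c) := by linarith [Real.add_one_le_exp (p - c)]
  have h2 : δ * Real.exp p = 1 / 12 * Real.exp (p - c) := by
    rw [← hec, mul_assoc, ← Real.exp_add]; congr 2; ring
  rw [h2]; linarith

/-- the regularised kernel in `p` -/
def kr (n : ℕ) (e L δ p : ℝ) : ℂ := Complex.exp (-(((δ:ℂ) - Complex.I * e) * (Real.exp p : ℝ))) *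
         (Jb n (2 * Real.exp ((L - p) / 2)) : ℂ)

lemma kr_continuous (n : ℕ) (e L δ : ℝ) : Continuous (kr n e L δ) := by
  have := Jb_continuous n
  unfold kr
  fun_prop

lemma kr_norm_le (n : ℕ) (e L : ℝ) {δ : ℝ} (hδ : 0 ≤ δ) (p : ℝ) : ‖kr n e L δ p‖ ≤ 1 := by
  rw [kr, norm_mul, Complex.norm_exp, Complex.norm_real]
  have h := Jb_abs_le n (2 * Real.exp ((L - p) / 2))
  have h2 : Real.exp (-(((δ:ℂ) - Complex.I * e) * (Real.exp p : ℝ))).re ≤ 1 := by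
    rw [Real.exp_le_one_iff, Complex.neg_re, Complex.re_mul_ofReal]
    simp
    have := Real.exp_pos p
    positivity
  calc _ ≤ (1:ℝ) * 1 := mul_le_mul h2 h (abs_nonneg _) zero_le_one
    _ = 1 := one_mul 1

lemma kr_integrable (n : ℕ) (e L : ℝ) {δ : ℝ} (hδ : 0 < δ) : Integrable (kr n e L δ) := by
  obtain ⟨M, hM⟩ := exp_lin_bdd hδ
  have h1 := (fQ_integrable n).comp_sub_left L
  have h2 := (h1.const_mul (Complex.exp (-(L:ℂ) / 12))).bdd_mul (c := M)
    (f := fun p : ℝ => Complex.exp ((1 / 12 : ℂ) * p - ((δ:ℂ) - Complex.I * e) * (Real.exp p : ℝ)))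
    (Continuous.aestronglyMeasurable (by fun_prop)) (Filter.Eventually.of_forall fun p => by
      rw [norm_cexp_sub_exp]
      convert hM p using 2
      simp)
  refine h2.congr (Filter.Eventually.of_forall fun p => ?_)
  simp only [fQ, kr]
  rw [← mul_assoc, ← mul_assoc, ← Complex.exp_add, ← Complex.exp_add]
  congr 2; push_cast; ring

section main
variable {A : ℝ → ℂ} {d : ℕ} {e L : ℝ}

lemma reg_main (hd : 2 ≤ d) (he : e = 1 ∨ e = -1) (hA : Integrable A) {δ : ℝ} (hδ : 0 < δ) :
    ∫ t : ℝ, A t * Complex.exp (-(t * L * Complex.I)) *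
      ∫ τ : ℝ, Qfun d ((1 / 12 : ℂ) + τ * Complex.I) *
        Complex.exp (-(((1 / 12 : ℂ) + τ * Complex.I) * L)) * Rg e δ (τ + 3 * t) =
    2 * π * ∫ p : ℝ, kr (d - 1) e L δ p *
      ∫ t : ℝ, A t * Complex.exp (t * ((3 * p - L : ℝ) : ℂ) * Complex.I) := by
  have hIntg : Integrable (Function.uncurry fun (t p : ℝ) =>
      Complex.exp (((t * (3 * p - L) : ℝ) : ℂ) * Complex.I) * (A t * kr (d - 1) e L δ p))
      (volume.prod volume) := by
    refine (hA.mul_prod (kr_integrable (d - 1) e L hδ)).bdd_mul (c := 1)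
      (Continuous.aestronglyMeasurable (by fun_prop)) (Filter.Eventually.of_forall fun x => ?_)
    rw [Complex.norm_exp_ofReal_mul_I]
  calc _ = ∫ t : ℝ, 2 * π * ∫ p : ℝ, Complex.exp (((t * (3 * p - L) : ℝ) : ℂ) * Complex.I) *
        (A t * kr (d - 1) e L δ p) := by
        refine integral_congr_ae (ae_of_all _ fun t => ?_)
        beta_reduce
        rw [reg_identity hd he hδ t L, mul_left_comm, ← integral_const_mul]
        congr 1
        refine integral_congr_ae (ae_of_all _ fun p => ?_)
        beta_reduce
        rw [show (((t * (3 * p - L) : ℝ) : ℂ) * Complex.I) =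
          -(t * L * Complex.I) + 3 * t * p * Complex.I by push_cast; ring, Complex.exp_add, kr]
        ring
    _ = 2 * π * ∫ t : ℝ, ∫ p : ℝ, Complex.exp (((t * (3 * p - L) : ℝ) : ℂ) * Complex.I) *
        (A t * kr (d - 1) e L δ p) := integral_const_mul _ _
    _ = 2 * π * ∫ p : ℝ, ∫ t : ℝ, Complex.exp (((t * (3 * p - L) : ℝ) : ℂ) * Complex.I) *
        (A t * kr (d - 1) e L δ p) := by rw [integral_integral_swap hIntg]
    _ = _ := by
        congr 1
        refine integral_congr_ae (ae_of_all _ fun p => ?_)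
        beta_reduce
        rw [← integral_const_mul]
        refine integral_congr_ae (ae_of_all _ fun t => ?_)
        beta_reduce
        push_cast
        ring

lemma rpow_shift (τ t : ℝ) : (1 + |τ + 3 * t|) ^ (-(5 / 12) : ℝ) ≤
    (1 + |τ|) ^ (-(5 / 12) : ℝ) * (1 + 3 * |t|) := by
  have h1 : 1 + |τ| ≤ (1 + |τ + 3 * t|) * (1 + 3 * |t|) := by
    have : |τ| ≤ |τ + 3 * t| + 3 * |t| := by
      calc |τ| = |(τ + 3 * t) - 3 * t| := by congr 1; ring
        _ ≤ |τ + 3 * t| + |3 * t| := abs_sub _ _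
        _ = _ := by rw [abs_mul]; norm_num
    nlinarith [abs_nonneg (τ + 3 * t), abs_nonneg t, mul_nonneg (abs_nonneg (τ + 3 * t)) (abs_nonneg t)]
  have ha := abs_nonneg τ
  have hb := abs_nonneg t
  have hc := abs_nonneg (τ + 3 * t)
  have h2 : (1 + |τ|) ^ (5 / 12 : ℝ) ≤ (1 + |τ + 3 * t|) ^ (5 / 12 : ℝ) * (1 + 3 * |t|) := by
    calc _ ≤ ((1 + |τ + 3 * t|) * (1 + 3 * |t|)) ^ (5 / 12 : ℝ) := by gcongr
      _ = (1 + |τ + 3 * t|) ^ (5 / 12 : ℝ) * (1 + 3 * |t|) ^ (5 / 12 : ℝ) :=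
        Real.mul_rpow (by positivity) (by positivity)
      _ ≤ (1 + |τ + 3 * t|) ^ (5 / 12 : ℝ) * (1 + 3 * |t|) ^ (1 : ℝ) := by
        gcongr
        · linarith
        · norm_num
      _ = _ := by rw [Real.rpow_one]
  rw [Real.rpow_neg (by positivity), Real.rpow_neg (by positivity)]
  rw [inv_le_iff_one_le_mul₀ (by positivity)]
  have h3 : 0 < (1 + |τ|) ^ (5 / 12 : ℝ) := by positivity
  calc (1:ℝ) = ((1 + |τ|) ^ (5 / 12 : ℝ))⁻¹ * (1 + |τ|) ^ (5 / 12 : ℝ) := by field_simp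
    _ ≤ ((1 + |τ|) ^ (5 / 12 : ℝ))⁻¹ * ((1 + |τ + 3 * t|) ^ (5 / 12 : ℝ) * (1 + 3 * |t|)) := by
      gcongr
    _ = _ := by ring

/-- integrand on the product -/
def Ig (A : ℝ → ℂ) (d : ℕ) (e L δ : ℝ) (x : ℝ × ℝ) : ℂ :=
  A x.1 * Complex.exp (-(x.1 * L * Complex.I)) *
      (Qfun d ((1 / 12 : ℂ) + x.2 * Complex.I) *
        Complex.exp (-(((1 / 12 : ℂ) + x.2 * Complex.I) * L)) * Rg e δ (x.2 + 3 * x.1))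

lemma Ig_bound (hd : 2 ≤ d) (he : e = 1 ∨ e = -1) (L : ℝ) : ∃ C : ℝ, 0 < C ∧
    ∀ δ : ℝ, 0 ≤ δ → ∀ x : ℝ × ℝ, ‖Ig A d e L δ x‖ ≤
      ((1 + 3 * |x.1|) * ‖A x.1‖) * (C * (1 + |x.2|) ^ (-(5 / 4) : ℝ)) := by
  obtain ⟨C, hC, h⟩ := Rg_bound
  obtain ⟨C', hC', h'⟩ := Q_bound hd
  refine ⟨Real.exp (-L / 12) * C' * C, by positivity, fun δ hδ x => ?_⟩
  rw [Ig, norm_mul, norm_mul, norm_mul, norm_mul]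
  have h1 : ‖Complex.exp (-(x.1 * L * Complex.I))‖ = 1 := by
    rw [show -((x.1:ℂ) * L * Complex.I) = ((-(x.1 * L) : ℝ) : ℂ) * Complex.I by push_cast; ring,
      Complex.norm_exp_ofReal_mul_I]
  have h2 : ‖Complex.exp (-(((1 / 12 : ℂ) + x.2 * Complex.I) * L))‖ = Real.exp (-L / 12) := by
    rw [Complex.norm_exp]; congr 1; simp; ring
  have h3 : ‖Rg e δ (x.2 + 3 * x.1)‖ ≤ C * ((1 + |x.2|) ^ (-(5 / 12) : ℝ) * (1 + 3 * |x.1|)) := by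
    refine (h e he δ _ hδ).trans ?_
    have h4 : Real.exp (-((π / 2 - |Complex.arg ((δ:ℂ) - Complex.I * e)|) * |x.2 + 3 * x.1|)) ≤ 1 := by
      rw [Real.exp_le_one_iff, neg_nonpos]
      have := arg_reg_le (e := e) hδ
      have : 0 ≤ π / 2 - |Complex.arg ((δ:ℂ) - Complex.I * e)| := by linarith
      positivity
    calc _ ≤ C * (1 + |x.2 + 3 * x.1|) ^ (-(5 / 12) : ℝ) * 1 := by gcongr
      _ ≤ _ := by
        rw [mul_one]
        exact mul_le_mul_of_nonneg_left (rpow_shift _ _) hC.le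
  have h5 : (1 + |x.2|) ^ (-(5 / 4) : ℝ) = (1 + |x.2|) ^ (-(5 / 6) : ℝ) * (1 + |x.2|) ^ (-(5 / 12) : ℝ) := by
    rw [← Real.rpow_add (by positivity)]; norm_num
  rw [h1, h2, h5, mul_one]
  calc _ ≤ ‖A x.1‖ * (C' * (1 + |x.2|) ^ (-(5 / 6) : ℝ) * Real.exp (-L / 12) *
        (C * ((1 + |x.2|) ^ (-(5 / 12) : ℝ) * (1 + 3 * |x.1|)))) := by
        gcongr
        exact h' _
    _ = _ := by ring

lemma Ig_continuous (hd : 2 ≤ d) (he : e = 1 ∨ e = -1) (hAc : Continuous A) (δ : ℝ) :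
    Continuous (Ig A d e L δ) := by
  unfold Ig
  have h1 := (Q_continuous hd).comp (continuous_snd (X := ℝ) (Y := ℝ))
  have h2 := (Rg_continuous (δ := δ) he).comp
    (show Continuous (fun x : ℝ × ℝ => x.2 + 3 * x.1) by fun_prop)
  refine Continuous.mul (by fun_prop) (Continuous.mul (Continuous.mul h1 (by fun_prop)) h2)

lemma dom_integrable (hA1 : Integrable (fun t => (1 + 3 * |t|) * ‖A t‖)) (C : ℝ) :
    Integrable (fun x : ℝ × ℝ => ((1 + 3 * |x.1|) * ‖A x.1‖) * (C * (1 + |x.2|) ^ (-(5 / 4) : ℝ)))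
      (volume.prod volume) := by
  have : Integrable (fun τ : ℝ => (1 + ‖τ‖) ^ (-(5 / 4) : ℝ)) :=
    integrable_one_add_norm (by simp; norm_num)
  exact hA1.mul_prod (this.const_mul C)

lemma Ig_integrable (hd : 2 ≤ d) (he : e = 1 ∨ e = -1) (hAc : Continuous A)
    (hA1 : Integrable (fun t => (1 + 3 * |t|) * ‖A t‖)) {δ : ℝ} (hδ : 0 ≤ δ) :
    Integrable (Ig A d e L δ) (volume.prod volume) := by
  obtain ⟨C, hC, h⟩ := Ig_bound (A := A) hd he L
  exact (dom_integrable hA1 C).mono' (Ig_continuous hd he hAc δ).aestronglyMeasurable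
    (ae_of_all _ (h δ hδ))

lemma Ig_integral (hd : 2 ≤ d) (he : e = 1 ∨ e = -1) (hAc : Continuous A)
    (hA1 : Integrable (fun t => (1 + 3 * |t|) * ‖A t‖)) {δ : ℝ} (hδ : 0 ≤ δ) :
    ∫ x, Ig A d e L δ x ∂(volume.prod volume) =
    ∫ t : ℝ, A t * Complex.exp (-(t * L * Complex.I)) *
      ∫ τ : ℝ, Qfun d ((1 / 12 : ℂ) + τ * Complex.I) *
        Complex.exp (-(((1 / 12 : ℂ) + τ * Complex.I) * L)) * Rg e δ (τ + 3 * t) := by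
  rw [integral_prod _ (Ig_integrable hd he hAc hA1 hδ)]
  refine integral_congr_ae (ae_of_all _ fun t => ?_)
  simp only [Ig]
  rw [integral_const_mul]

lemma main_id (hd : 2 ≤ d) (he : e = 1 ∨ e = -1) (hAc : Continuous A) (hA : Integrable A)
    (hA1 : Integrable (fun t => (1 + 3 * |t|) * ‖A t‖)) {H : ℝ → ℂ} (hHi : Integrable H)
    (hH : ∀ v : ℝ, ∫ t : ℝ, A t * Complex.exp (t * (v : ℂ) * Complex.I) = H v) :
    ∫ t : ℝ, A t * Complex.exp (-(t * L * Complex.I)) *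
      ∫ τ : ℝ, Qfun d ((1 / 12 : ℂ) + τ * Complex.I) *
        Complex.exp (-(((1 / 12 : ℂ) + τ * Complex.I) * L)) * Rg e 0 (τ + 3 * t) =
    2 * π * ∫ p : ℝ, kr (d - 1) e L 0 p * H (3 * p - L) := by
  obtain ⟨C, hC, hb⟩ := Ig_bound (A := A) hd he L
  have hl : Filter.Tendsto (fun δ : ℝ => ∫ x, Ig A d e L δ x ∂(volume.prod volume))
      (nhdsWithin 0 (Set.Ioi 0)) (nhds (∫ x, Ig A d e L 0 x ∂(volume.prod volume))) := by
    refine tendsto_integral_filter_of_dominated_convergence _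
      (Filter.Eventually.of_forall fun δ => (Ig_continuous hd he hAc δ).aestronglyMeasurable)
      ?_ (dom_integrable hA1 C) (ae_of_all _ fun x => ?_)
    · filter_upwards [self_mem_nhdsWithin] with δ hδ
      exact ae_of_all _ (hb δ (le_of_lt hδ))
    · unfold Ig
      exact ((Rg_tendsto he _).const_mul _).const_mul _
  have hHi2 : Integrable (fun p => H (3 * p - L)) :=
    (hHi.comp_sub_right L).comp_mul_left' (R := 3) (by norm_num)
  have hr : Filter.Tendsto (fun δ : ℝ => 2 * π * ∫ p : ℝ, kr (d - 1) e L δ p * H (3 * p - L))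
      (nhdsWithin 0 (Set.Ioi 0)) (nhds (2 * π * ∫ p : ℝ, kr (d - 1) e L 0 p * H (3 * p - L))) := by
    refine Filter.Tendsto.const_mul _ ?_
    refine tendsto_integral_filter_of_dominated_convergence (fun p => ‖H (3 * p - L)‖)
      (Filter.Eventually.of_forall fun δ =>
        (kr_continuous _ e L δ).aestronglyMeasurable.mul hHi2.aestronglyMeasurable)
      ?_ hHi2.norm (ae_of_all _ fun p => ?_)
    · filter_upwards [self_mem_nhdsWithin] with δ hδ
      refine ae_of_all _ fun p => ?_
      rw [norm_mul]
      exact mul_le_of_le_one_left (norm_nonneg _) (kr_norm_le _ e L (le_of_lt hδ) p)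
    · refine Filter.Tendsto.mono_left ?_ nhdsWithin_le_nhds
      refine Filter.Tendsto.mul_const _ ?_
      unfold kr
      exact Continuous.tendsto (by fun_prop) 0
  rw [← Ig_integral hd he hAc hA1 le_rfl]
  refine tendsto_nhds_unique hl (hr.congr' ?_)
  filter_upwards [self_mem_nhdsWithin] with δ hδ
  rw [Ig_integral hd he hAc hA1 (le_of_lt hδ), reg_main hd he hA hδ]
  simp_rw [hH]
end main

/-- Gaussian oscillating factor -/
def ge (w x : ℝ) : ℂ := Complex.exp (-(x:ℂ) ^ 2 + Complex.I * w * x)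

lemma ge_norm (w x : ℝ) : ‖ge w x‖ = Real.exp (-x ^ 2) := by
  rw [ge, Complex.norm_exp]; congr 1; simp [pow_two]

lemma ge_continuous (w : ℝ) : Continuous (ge w) := by unfold ge; fun_prop

lemma gauss_half_integrable : Integrable (fun x : ℝ => 2 * Real.exp (-(1 / 2) * x ^ 2)) :=
  (integrable_exp_neg_mul_sq (by norm_num)).const_mul 2

lemma ge_poly_le (w x : ℝ) (c : ℝ) (hc : |c| ≤ 1 + x ^ 2) : ‖(c:ℂ) * ge w x‖ ≤
    2 * Real.exp (-(1 / 2) * x ^ 2) := by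
  rw [norm_mul, ge_norm, Complex.norm_real, Real.norm_eq_abs]
  have h1 : 1 + x ^ 2 ≤ 2 * Real.exp (x ^ 2 / 2) := by
    have := Real.add_one_le_exp (x ^ 2 / 2); linarith [sq_nonneg x]
  calc _ ≤ (2 * Real.exp (x ^ 2 / 2)) * Real.exp (-x ^ 2) := by gcongr; linarith
    _ = 2 * (Real.exp (x ^ 2 / 2) * Real.exp (-x ^ 2)) := by ring
    _ = _ := by rw [← Real.exp_add]; congr 2; ring

lemma ge_poly_integrable (w : ℝ) {c : ℝ → ℝ} (hcc : Continuous c) (hc : ∀ x, |c x| ≤ 1 + x ^ 2) :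
    Integrable (fun x => (c x:ℂ) * ge w x) := by
  refine gauss_half_integrable.mono' ?_ (ae_of_all _ fun x => ge_poly_le w x _ (hc x))
  have := ge_continuous w
  exact Continuous.aestronglyMeasurable (by fun_prop)

lemma ge_int0 (w : ℝ) : Integrable (ge w) := by
  have := ge_poly_integrable w (c := fun _ => 1) continuous_const (fun x => by simp; positivity)
  simpa using this

lemma ge_int1 (w : ℝ) : Integrable (fun x : ℝ => (x:ℂ) * ge w x) :=
  ge_poly_integrable w (c := fun x => x) continuous_id (fun x => by
    rcases abs_cases x with h | h <;> nlinarith [sq_nonneg (x - 1), sq_nonneg (x + 1)])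

lemma ge_int2 (w : ℝ) : Integrable (fun x : ℝ => (x:ℂ) ^ 2 * ge w x) := by
  have := ge_poly_integrable w (c := fun x => x ^ 2) (by fun_prop) (fun x => by
    rw [abs_of_nonneg (by positivity)]; linarith)
  simpa using this

lemma ge_E0 (w : ℝ) : ∫ x : ℝ, ge w x = (√π * Real.exp (-w ^ 2 / 4) : ℝ) := by
  have := integral_cexp_quadratic (b := -1) (by simp) (Complex.I * w) 0
  have e : ∀ x : ℝ, ge w x = Complex.exp (-1 * (x:ℂ) ^ 2 + Complex.I * w * x + 0) := by
    intro x; rw [ge]; congr 1; ring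
  simp_rw [e]
  rw [this, show (π:ℂ) / -(-1) = π by ring]
  have hsq : ((π:ℂ)) ^ (1 / 2 : ℂ) = ((√π : ℝ) : ℂ) := by
    rw [Real.sqrt_eq_rpow, Complex.ofReal_cpow Real.pi_pos.le]; norm_num
  rw [hsq]
  push_cast
  congr 2
  rw [mul_pow, Complex.I_sq]; ring

lemma ge_hasDerivAt (w x : ℝ) : HasDerivAt (ge w) ((-2 * x + Complex.I * w) * ge w x) x := by
  have h : HasDerivAt (fun z : ℂ => Complex.exp (-z ^ 2 + Complex.I * w * z))
      (Complex.exp (-(x:ℂ) ^ 2 + Complex.I * w * x) * (-(2 * x) + Complex.I * w)) (x:ℂ) := by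
    refine HasDerivAt.cexp ?_
    have h1 := ((hasDerivAt_pow 2 (x:ℂ)).neg).add ((hasDerivAt_id (x:ℂ)).const_mul (Complex.I * w))
    refine h1.congr_deriv ?_
    simp
  refine h.comp_ofReal.congr_deriv ?_
  rw [ge]; ring

lemma ge_E1 (w : ℝ) : ∫ x : ℝ, (x:ℂ) * ge w x = Complex.I * w / 2 * ∫ x : ℝ, ge w x := by
  have i : Integrable (fun x : ℝ => (-2 : ℂ) * ((x:ℂ) * ge w x) + Complex.I * w * ge w x) :=
    ((ge_int1 w).const_mul _).add ((ge_int0 w).const_mul _)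
  have := integral_eq_zero_of_hasDerivAt_of_integrable (f := ge w) (fun x => ge_hasDerivAt w x)
    (i.congr (ae_of_all _ fun x => by ring)) (ge_int0 w)
  rw [show (fun x : ℝ => (-2 * (x:ℂ) + Complex.I * w) * ge w x) = fun x : ℝ =>
    (-2 : ℂ) * ((x:ℂ) * ge w x) + Complex.I * w * ge w x by ext x; ring,
    integral_add ((ge_int1 w).const_mul _) ((ge_int0 w).const_mul _), integral_const_mul,
    integral_const_mul] at this
  linear_combination (-1 / 2 : ℂ) * this

lemma ge_E2 (w : ℝ) : ∫ x : ℝ, (x:ℂ) ^ 2 * ge w x = (1 / 2 - w ^ 2 / 4) * ∫ x : ℝ, ge w x := by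
  have i : Integrable (fun x : ℝ => ge w x + ((-2 : ℂ) * ((x:ℂ) ^ 2 * ge w x) +
      Complex.I * w * ((x:ℂ) * ge w x))) :=
    (ge_int0 w).add (((ge_int2 w).const_mul _).add ((ge_int1 w).const_mul _))
  have hd : ∀ x : ℝ, HasDerivAt (fun x : ℝ => (x:ℂ) * ge w x)
      (1 * ge w x + x * ((-2 * x + Complex.I * w) * ge w x)) x := fun x =>
    (Complex.ofRealCLM.hasDerivAt (x := x)).mul (ge_hasDerivAt w x)
  have := integral_eq_zero_of_hasDerivAt_of_integrable hd
    (i.congr (ae_of_all _ fun x => by ring)) (ge_int1 w)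
  rw [show (fun x : ℝ => 1 * ge w x + x * ((-2 * x + Complex.I * w) * ge w x)) = fun x : ℝ =>
    ge w x + ((-2 : ℂ) * ((x:ℂ) ^ 2 * ge w x) + Complex.I * w * ((x:ℂ) * ge w x)) by ext x; ring,
    integral_add (g := fun x : ℝ => (-2 : ℂ) * ((x:ℂ) ^ 2 * ge w x) +
      Complex.I * w * ((x:ℂ) * ge w x)) (ge_int0 w)
      (((ge_int2 w).const_mul _).add ((ge_int1 w).const_mul _)),
    integral_add ((ge_int2 w).const_mul _) ((ge_int1 w).const_mul _), integral_const_mul,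
    integral_const_mul, ge_E1] at this
  linear_combination (-1 / 2 : ℂ) * this + (w ^ 2 / 4 * ∫ x : ℝ, ge w x) * Complex.I_sq

/-- spectral weight -/
def Aw (a b V ρ t : ℝ) : ℂ := ((Real.exp (-(t - ρ) ^ 2 / V) * (a + b * t ^ 2) : ℝ) : ℂ)

/-- its Fourier transform -/
def Hw (a b V ρ v : ℝ) : ℂ := Complex.exp (Complex.I * ρ * v) *
  ((√V * (√π * Real.exp (-(√V * v) ^ 2 / 4)) : ℝ) : ℂ) *
  ((a + b * ρ ^ 2) + 2 * b * ρ * √V * (Complex.I * (√V * v) / 2) +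
    b * V * (1 / 2 - (√V * v) ^ 2 / 4))

lemma Aw_continuous (a b V ρ : ℝ) : Continuous (Aw a b V ρ) := by
  unfold Aw
  exact Complex.continuous_ofReal.comp (by fun_prop)

lemma Hw_continuous (a b V ρ : ℝ) : Continuous (Hw a b V ρ) := by
  unfold Hw
  fun_prop

lemma Aw_fourier (a b : ℝ) {V : ℝ} (hV : 0 < V) (ρ v : ℝ) :
    ∫ t : ℝ, Aw a b V ρ t * Complex.exp (t * (v:ℂ) * Complex.I) = Hw a b V ρ v := by
  have hs : 0 < √V := Real.sqrt_pos.2 hV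
  have hsq : √V ^ 2 = V := Real.sq_sqrt hV.le
  have e1 := Measure.integral_comp_mul_left (fun u : ℝ => Aw a b V ρ (u + ρ) *
    Complex.exp (((u + ρ : ℝ):ℂ) * (v:ℂ) * Complex.I)) (√V)
  rw [integral_add_right_eq_self (fun t : ℝ => Aw a b V ρ t *
    Complex.exp ((t:ℂ) * (v:ℂ) * Complex.I)) ρ] at e1
  rw [abs_of_pos (by positivity), Complex.real_smul] at e1
  have hsC : ((√V : ℝ) : ℂ) ≠ 0 := by exact_mod_cast hs.ne'
  have e2 : ∀ x : ℝ, Aw a b V ρ (√V * x + ρ) * Complex.exp (((√V * x + ρ : ℝ):ℂ) * (v:ℂ) * Complex.I)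
      = Complex.exp (Complex.I * ρ * v) * ((a + b * ρ ^ 2) * ge (√V * v) x + ((2 * b * ρ * √V) *
        ((x:ℂ) * ge (√V * v) x) + b * V * ((x:ℂ) ^ 2 * ge (√V * v) x))) := by
    intro x
    have e3 : Real.exp (-(√V * x + ρ - ρ) ^ 2 / V) = Real.exp (-x ^ 2) := by
      congr 1
      rw [add_sub_cancel_right, mul_pow, hsq]; field_simp
    rw [Aw, e3]
    have e4 : (Real.exp (-x ^ 2) : ℂ) * Complex.exp (((√V * x + ρ : ℝ):ℂ) * (v:ℂ) * Complex.I) =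
        Complex.exp (Complex.I * ρ * v) * ge (√V * v) x := by
      rw [ge, Complex.ofReal_exp, ← Complex.exp_add, ← Complex.exp_add]
      congr 1; push_cast; ring
    have hsqC : ((√V : ℝ) : ℂ) ^ 2 = V := by exact_mod_cast hsq
    rw [Complex.ofReal_mul, mul_right_comm, e4]
    push_cast
    linear_combination (Complex.exp (Complex.I * ρ * v) * ge (√V * v) x * b * x ^ 2) * hsqC
  simp only [e2] at e1
  have i0 := (ge_int0 (√V * v)).const_mul ((a:ℂ) + b * ρ ^ 2)
  have i1 := (ge_int1 (√V * v)).const_mul (2 * (b:ℂ) * ρ * √V)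
  have i2 := (ge_int2 (√V * v)).const_mul ((b:ℂ) * V)
  rw [integral_const_mul, integral_add (g := fun x : ℝ => 2 * (b:ℂ) * ρ * √V * (x * ge (√V * v) x) +
    b * V * ((x:ℂ) ^ 2 * ge (√V * v) x)) i0 (i1.add i2), integral_add i1 i2, integral_const_mul,
    integral_const_mul, integral_const_mul, ge_E1, ge_E2, ge_E0] at e1
  push_cast at e1
  rw [eq_inv_mul_iff_mul_eq₀ hsC] at e1
  rw [← e1, Hw]
  push_cast
  ring

lemma Hw_bound {a b V : ℝ} (ha : 0 ≤ a) (hb : 0 ≤ b) (hV : 0 < V) (ρ v : ℝ) :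
    ‖Hw a b V ρ v‖ ≤ 8 * √π * (a + 2 * b * ρ ^ 2 + 2 * b * V) * (√V * Real.exp (-(V * v ^ 2) / 8)) := by
  have hs : 0 < √V := Real.sqrt_pos.2 hV
  have hsq : √V ^ 2 = V := Real.sq_sqrt hV.le
  set w := √V * v with hw
  have hw2 : w ^ 2 = V * v ^ 2 := by rw [hw, mul_pow, hsq]
  have h1 : ‖(((a:ℂ) + b * ρ ^ 2) + 2 * b * ρ * √V * (Complex.I * (√V * v) / 2) +
    b * V * (1 / 2 - (√V * v) ^ 2 / 4))‖ ≤ (a + 2 * b * ρ ^ 2 + 2 * b * V) * (1 + w ^ 2) := by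
    have t1 : ‖(a:ℂ) + b * ρ ^ 2‖ = a + b * ρ ^ 2 := by
      rw [show (a:ℂ) + b * ρ ^ 2 = ((a + b * ρ ^ 2 : ℝ) : ℂ) by push_cast; ring, Complex.norm_real,
        Real.norm_of_nonneg (by positivity)]
    have t2 : ‖2 * (b:ℂ) * ρ * √V * (Complex.I * (√V * v) / 2)‖ = b * (|ρ| * √V * |w|) := by
      rw [show 2 * (b:ℂ) * ρ * √V * (Complex.I * (√V * v) / 2) = ((b * (ρ * √V * w) : ℝ) : ℂ) *
        Complex.I by rw [hw]; push_cast; ring, norm_mul, Complex.norm_I, mul_one, Complex.norm_real,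
        Real.norm_eq_abs, abs_mul, abs_mul, abs_mul, abs_of_nonneg hb, abs_of_pos hs]
    have t3 : ‖(b:ℂ) * V * (1 / 2 - (√V * v) ^ 2 / 4)‖ ≤ b * V * (1 / 2 + w ^ 2 / 4) := by
      rw [show (b:ℂ) * V * (1 / 2 - (√V * v) ^ 2 / 4) = ((b * V * (1 / 2 - w ^ 2 / 4) : ℝ) : ℂ) by
        rw [hw]; push_cast; ring, Complex.norm_real, Real.norm_eq_abs, abs_mul, abs_of_nonneg
        (by positivity)]
      gcongr
      rw [abs_le]; constructor <;> nlinarith [sq_nonneg w]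
    have t4 : |ρ| * √V * |w| ≤ (ρ ^ 2 + V) * (1 + w ^ 2) := by
      have k1 : |ρ| * √V ≤ ρ ^ 2 + V := by
        nlinarith [sq_nonneg (|ρ| - √V), sq_abs ρ, sq_nonneg ρ]
      have k2 : |w| ≤ 1 + w ^ 2 := by nlinarith [sq_nonneg (|w| - 1), sq_abs w]
      exact mul_le_mul k1 k2 (abs_nonneg _) (by positivity)
    have t5 : b * (|ρ| * √V * |w|) ≤ b * ((ρ ^ 2 + V) * (1 + w ^ 2)) := by gcongr
    refine (norm_add_le _ _).trans ((add_le_add (norm_add_le _ _) t3).trans ?_)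
    rw [t1, t2]
    have z1 : 0 ≤ a * w ^ 2 := by positivity
    have z2 : 0 ≤ b * ρ ^ 2 * w ^ 2 := by positivity
    have z3 : 0 ≤ b * V * w ^ 2 := by positivity
    have z4 : 0 ≤ b * V := by positivity
    nlinarith
  have h2 : (1 + w ^ 2) ≤ 8 * Real.exp (w ^ 2 / 8) := by
    have := Real.add_one_le_exp (w ^ 2 / 8); linarith [sq_nonneg w]
  have h3 : ‖Complex.exp (Complex.I * ρ * v)‖ = 1 := by
    rw [show Complex.I * (ρ:ℂ) * v = ((ρ * v : ℝ) : ℂ) * Complex.I by push_cast; ring,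
      Complex.norm_exp_ofReal_mul_I]
  rw [Hw, norm_mul, norm_mul, h3, one_mul, Complex.norm_real, Real.norm_of_nonneg (by positivity), ← hw]
  calc _ ≤ (√V * (√π * Real.exp (-w ^ 2 / 4))) *
        ((a + 2 * b * ρ ^ 2 + 2 * b * V) * (8 * Real.exp (w ^ 2 / 8))) := by
        gcongr
        exact h1.trans (by gcongr)
    _ = 8 * √π * (a + 2 * b * ρ ^ 2 + 2 * b * V) * (√V * (Real.exp (-w ^ 2 / 4) * Real.exp (w ^ 2 / 8))) := by
        ring
    _ = _ := by
        rw [← Real.exp_add, ← hw2]; congr 4; ring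

lemma Aw_weighted_integrable {a b V : ℝ} (ha : 0 ≤ a) (hb : 0 ≤ b) (hV : 0 < V) (ρ : ℝ) :
    Integrable (fun t => (1 + 3 * |t|) * ‖Aw a b V ρ t‖) := by
  have hi : Integrable (fun t : ℝ => (3 * (a + 2 * b) * Real.exp (2 * |ρ| + 2 * V)) *
      Real.exp (-(1 / (2 * V)) * (t - ρ) ^ 2)) :=
    ((integrable_exp_neg_mul_sq (b := 1 / (2 * V)) (by positivity)).comp_sub_right ρ).const_mul _
  refine hi.mono' (Continuous.aestronglyMeasurable (by
    have := Aw_continuous a b V ρ; fun_prop)) (ae_of_all _ fun t => ?_)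
  rw [Real.norm_of_nonneg (by positivity), Aw, Complex.norm_real, Real.norm_of_nonneg (by positivity)]
  have ht := abs_nonneg t
  have h1 : 1 + 3 * |t| ≤ 3 * Real.exp |t| := by linarith [Real.add_one_le_exp |t|]
  have h2 : a + b * t ^ 2 ≤ (a + 2 * b) * Real.exp |t| := by
    have k1 := Real.quadratic_le_exp_of_nonneg ht
    have k2 : 1 ≤ Real.exp |t| := Real.one_le_exp ht
    have k3 : t ^ 2 ≤ 2 * Real.exp |t| := by rw [sq_abs] at k1; linarith
    nlinarith
  have h3 : Real.exp |t| * Real.exp |t| * Real.exp (-(t - ρ) ^ 2 / V) ≤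
      Real.exp (2 * |ρ| + 2 * V) * Real.exp (-(1 / (2 * V)) * (t - ρ) ^ 2) := by
    rw [← Real.exp_add, ← Real.exp_add, ← Real.exp_add, Real.exp_le_exp]
    have k1 : |t| ≤ |t - ρ| + |ρ| := by
      calc |t| = |(t - ρ) + ρ| := by congr 1; ring
        _ ≤ _ := abs_add_le _ _
    have k2 : 2 * |t - ρ| ≤ (t - ρ) ^ 2 / (2 * V) + 2 * V := by
      rw [← sq_abs (t - ρ)]
      rw [div_add' _ _ _ (by positivity), le_div_iff₀ (by positivity)]
      nlinarith [sq_nonneg (|t - ρ| - 2 * V)]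
    have k3 : -(t - ρ) ^ 2 / V = -(2 * ((t - ρ) ^ 2 / (2 * V))) := by field_simp
    have k4 : -(1 / (2 * V)) * (t - ρ) ^ 2 = -((t - ρ) ^ 2 / (2 * V)) := by ring
    rw [k3, k4]; linarith
  calc _ ≤ (3 * Real.exp |t|) * (Real.exp (-(t - ρ) ^ 2 / V) * ((a + 2 * b) * Real.exp |t|)) := by
        gcongr
    _ = 3 * (a + 2 * b) * (Real.exp |t| * Real.exp |t| * Real.exp (-(t - ρ) ^ 2 / V)) := by ring
    _ ≤ 3 * (a + 2 * b) * (Real.exp (2 * |ρ| + 2 * V) * Real.exp (-(1 / (2 * V)) * (t - ρ) ^ 2)) := by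
        gcongr
    _ = _ := by ring

lemma Aw_integrable {a b V : ℝ} (ha : 0 ≤ a) (hb : 0 ≤ b) (hV : 0 < V) (ρ : ℝ) :
    Integrable (Aw a b V ρ) := by
  refine (Aw_weighted_integrable ha hb hV ρ).mono' (Aw_continuous a b V ρ).aestronglyMeasurable
    (ae_of_all _ fun t => ?_)
  exact le_mul_of_one_le_left (norm_nonneg _) (by linarith [abs_nonneg t])

/-- weighted bound -/
lemma Hw_wbound (k : ℝ) {a b V : ℝ} (ha : 0 ≤ a) (hb : 0 ≤ b) (hV : 1 ≤ V) (hk : 0 ≤ k) (ρ v : ℝ) :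
    Real.exp (k * |v|) * ‖Hw a b V ρ v‖ ≤ (8 * √π * Real.exp (4 * k ^ 2)) *
      (a + 2 * b * ρ ^ 2 + 2 * b * V) * (√V * Real.exp (-(V / 16) * v ^ 2)) := by
  have hV0 : 0 < V := by linarith
  have h := Hw_bound ha hb hV0 ρ v
  have h1 : Real.exp (k * |v|) * Real.exp (-(V * v ^ 2) / 8) ≤
      Real.exp (4 * k ^ 2) * Real.exp (-(V / 16) * v ^ 2) := by
    rw [← Real.exp_add, ← Real.exp_add, Real.exp_le_exp]
    have : k * |v| ≤ 4 * k ^ 2 + v ^ 2 / 16 := by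
      nlinarith [sq_nonneg (2 * k - |v| / 4), sq_abs v]
    nlinarith [sq_nonneg v]
  calc _ ≤ Real.exp (k * |v|) * (8 * √π * (a + 2 * b * ρ ^ 2 + 2 * b * V) *
        (√V * Real.exp (-(V * v ^ 2) / 8))) := by gcongr
    _ = 8 * √π * (a + 2 * b * ρ ^ 2 + 2 * b * V) * √V *
        (Real.exp (k * |v|) * Real.exp (-(V * v ^ 2) / 8)) := by ring
    _ ≤ 8 * √π * (a + 2 * b * ρ ^ 2 + 2 * b * V) * √V *
        (Real.exp (4 * k ^ 2) * Real.exp (-(V / 16) * v ^ 2)) := by gcongr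
    _ = _ := by ring

lemma gaussV_integrable {V : ℝ} (hV : 0 < V) : Integrable (fun v : ℝ => √V * Real.exp (-(V / 16) * v ^ 2)) :=
  (integrable_exp_neg_mul_sq (b := V / 16) (by positivity)).const_mul _

lemma gaussV_integral {V : ℝ} (hV : 0 < V) : ∫ v : ℝ, √V * Real.exp (-(V / 16) * v ^ 2) = 4 * √π := by
  rw [integral_const_mul, integral_gaussian, ← Real.sqrt_mul hV.le,
    show V * (π / (V / 16)) = 4 ^ 2 * π by field_simp; norm_num, Real.sqrt_mul (by norm_num),
    Real.sqrt_sq (by norm_num)]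

lemma Hw_integrable {a b V : ℝ} (ha : 0 ≤ a) (hb : 0 ≤ b) (hV : 1 ≤ V) (k : ℝ) (hk : 0 ≤ k) (ρ : ℝ) :
    Integrable (fun v => Real.exp (k * |v|) * ‖Hw a b V ρ v‖) := by
  refine ((gaussV_integrable (V := V) (by linarith)).const_mul ((8 * √π * Real.exp (4 * k ^ 2)) *
      (a + 2 * b * ρ ^ 2 + 2 * b * V))).mono' (Continuous.aestronglyMeasurable (by
    have := Hw_continuous a b V ρ; fun_prop)) (ae_of_all _ fun v => ?_)
  rw [Real.norm_of_nonneg (by positivity)]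
  exact Hw_wbound k ha hb hV hk ρ v

lemma Hw_integral_le {a b V : ℝ} (ha : 0 ≤ a) (hb : 0 ≤ b) (hV : 1 ≤ V) (k : ℝ) (hk : 0 ≤ k) (ρ : ℝ) :
    ∫ v, Real.exp (k * |v|) * ‖Hw a b V ρ v‖ ≤ (8 * √π * Real.exp (4 * k ^ 2)) *
      (a + 2 * b * ρ ^ 2 + 2 * b * V) * (4 * √π) := by
  rw [← gaussV_integral (show 0 < V by linarith), ← integral_const_mul]
  exact integral_mono (Hw_integrable ha hb hV k hk ρ)
    ((gaussV_integrable (by linarith)).const_mul _) (fun v => Hw_wbound k ha hb hV hk ρ v)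

/-- phase -/
def ph (e : ℝ) (x : ℝ × ℝ) : ℝ := 2 * Real.exp (-x.1 / 6) * Real.sin x.2 + e * Real.exp (x.1 / 3)

/-- measure on `ℝ × (-π, π]` -/
def mu2 : Measure (ℝ × ℝ) := (volume : Measure ℝ).prod (volume.restrict (Set.Ioc (-π) π))

/-- integrand -/
def gk (H : ℝ → ℂ) (n : ℕ) (e : ℝ) (k : ℕ) (Z : ℝ) (x : ℝ × ℝ) : ℂ :=
  (Complex.I * ph e x) ^ k * (Complex.exp (((Z * ph e x - n * x.2 : ℝ) : ℂ) * Complex.I) * H x.1)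

/-- the derivatives -/
def Gk (H : ℝ → ℂ) (n : ℕ) (e : ℝ) (k : ℕ) (Z : ℝ) : ℂ := ∫ x, gk H n e k Z x ∂mu2

lemma ph_bound {e : ℝ} (he : e = 1 ∨ e = -1) (x : ℝ × ℝ) : |ph e x| ≤ 3 * Real.exp (1 / 3 * |x.1|) := by
  have h1 : Real.exp (-x.1 / 6) ≤ Real.exp (1 / 3 * |x.1|) := by
    apply Real.exp_le_exp.2; rcases abs_cases x.1 with h | h <;> linarith
  have h2 : Real.exp (x.1 / 3) ≤ Real.exp (1 / 3 * |x.1|) := by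
    apply Real.exp_le_exp.2; rcases abs_cases x.1 with h | h <;> linarith
  have h3 := Real.abs_sin_le_one x.2
  have he1 : |e| = 1 := by rcases he with rfl | rfl <;> simp
  calc |ph e x| ≤ |2 * Real.exp (-x.1 / 6) * Real.sin x.2| + |e * Real.exp (x.1 / 3)| := abs_add_le _ _
    _ = 2 * Real.exp (-x.1 / 6) * |Real.sin x.2| + Real.exp (x.1 / 3) := by
      rw [abs_mul, abs_mul, abs_mul, he1, Real.abs_exp, Real.abs_exp, abs_two, one_mul]
    _ ≤ 2 * Real.exp (1 / 3 * |x.1|) * 1 + Real.exp (1 / 3 * |x.1|) := by gcongr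
    _ = _ := by ring

lemma ph_continuous (e : ℝ) : Continuous (ph e) := by unfold ph; fun_prop

lemma gk_norm_le {H : ℝ → ℂ} (n : ℕ) {e : ℝ} (he : e = 1 ∨ e = -1) (k : ℕ) (Z : ℝ) (x : ℝ × ℝ) :
    ‖gk H n e k Z x‖ ≤ (3 ^ k * (Real.exp (k / 3 * |x.1|) * ‖H x.1‖)) * 1 := by
  rw [gk, norm_mul, norm_mul, Complex.norm_exp_ofReal_mul_I, norm_pow, norm_mul, Complex.norm_I,
    Complex.norm_real, Real.norm_eq_abs, one_mul, one_mul, mul_one]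
  have h := pow_le_pow_left₀ (abs_nonneg _) (ph_bound he x) k
  rw [mul_pow, ← Real.exp_nat_mul] at h
  rw [← mul_assoc]
  refine mul_le_mul_of_nonneg_right (h.trans_eq ?_) (norm_nonneg _)
  congr 2; ring

lemma gk_continuous {H : ℝ → ℂ} (hH : Continuous H) (n : ℕ) (e : ℝ) (k : ℕ) (Z : ℝ) :
    Continuous (gk H n e k Z) := by
  have := ph_continuous e
  unfold gk
  fun_prop

lemma dom2_integrable {H : ℝ → ℂ} (k : ℕ) (hHi : Integrable (fun v => Real.exp (k / 3 * |v|) * ‖H v‖)) :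
    Integrable (fun x : ℝ × ℝ => (3 ^ k * (Real.exp (k / 3 * |x.1|) * ‖H x.1‖)) * 1) mu2 := by
  refine (hHi.const_mul (3 ^ k)).mul_prod (g := fun _ : ℝ => (1:ℝ)) ?_
  exact integrable_const 1

lemma gk_integrable {H : ℝ → ℂ} (hH : Continuous H) (n : ℕ) {e : ℝ} (he : e = 1 ∨ e = -1) (k : ℕ)
    (hHi : Integrable (fun v => Real.exp (k / 3 * |v|) * ‖H v‖)) (Z : ℝ) :
    Integrable (gk H n e k Z) mu2 :=
  (dom2_integrable k hHi).mono' (gk_continuous hH n e k Z).aestronglyMeasurable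
    (ae_of_all _ (gk_norm_le n he k Z))

lemma Gk_norm_le {H : ℝ → ℂ} (n : ℕ) {e : ℝ} (he : e = 1 ∨ e = -1) (k : ℕ)
    (hHi : Integrable (fun v => Real.exp (k / 3 * |v|) * ‖H v‖)) (Z : ℝ) :
    ‖Gk H n e k Z‖ ≤ 3 ^ k * (2 * π) * ∫ v, Real.exp (k / 3 * |v|) * ‖H v‖ := by
  have h := norm_integral_le_of_norm_le (dom2_integrable k hHi)
    (ae_of_all _ (gk_norm_le (H := H) n he k Z))
  refine h.trans_eq ?_
  rw [mu2, integral_prod_mul (fun v => 3 ^ k * (Real.exp (k / 3 * |v|) * ‖H v‖)) (fun _ => (1:ℝ)),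
    integral_const_mul]
  have := Real.pi_pos
  simp [Measure.real]
  rw [ENNReal.toReal_ofReal (by linarith)]
  ring

lemma Gk_hasDerivAt {H : ℝ → ℂ} (hH : Continuous H) (n : ℕ) {e : ℝ} (he : e = 1 ∨ e = -1) (k : ℕ)
    (hHi : ∀ k : ℕ, Integrable (fun v => Real.exp (k / 3 * |v|) * ‖H v‖)) (Z : ℝ) :
    HasDerivAt (Gk H n e k) (Gk H n e (k + 1) Z) Z := by
  refine (hasDerivAt_integral_of_dominated_loc_of_deriv_le (s := Set.univ) Filter.univ_mem
    (Filter.Eventually.of_forall fun Z => (gk_continuous hH n e k Z).aestronglyMeasurable)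
    (gk_integrable hH n he k (hHi k) Z) (gk_continuous hH n e (k + 1) Z).aestronglyMeasurable
    (ae_of_all _ fun x Z _ => gk_norm_le n he (k + 1) Z x)
    (dom2_integrable (k + 1) (hHi (k + 1))) (ae_of_all _ fun x Z _ => ?_)).2
  unfold gk
  have h1 : HasDerivAt (fun Z : ℝ => ((Z * ph e x - n * x.2 : ℝ) : ℂ) * Complex.I)
      ((ph e x : ℂ) * Complex.I) Z := by
    have := (((hasDerivAt_id Z).mul_const (ph e x)).sub_const (n * x.2)).ofReal_comp.mul_const Complex.I
    refine this.congr_deriv ?_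
    simp
  have h2 := ((h1.cexp.mul_const (H x.1)).const_mul ((Complex.I * ph e x) ^ k))
  refine h2.congr_deriv ?_
  ring

lemma kr_int {H : ℝ → ℂ} (hH : Continuous H) (n : ℕ) {e : ℝ} (he : e = 1 ∨ e = -1)
    (hHi : Integrable (fun v => Real.exp ((0:ℕ) / 3 * |v|) * ‖H v‖)) (L : ℝ) :
    ∫ p : ℝ, kr n e L 0 p * H (3 * p - L) = 1 / (6 * π) * Gk H n e 0 (Real.exp (L / 3)) := by
  have hpi := Real.pi_pos
  have hpiC : (π:ℂ) ≠ 0 := by exact_mod_cast hpi.ne'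
  have e1 := Measure.integral_comp_mul_left (fun u : ℝ => kr n e L 0 (u / 3) * H (u - L)) 3
  rw [← integral_add_right_eq_self (fun u : ℝ => kr n e L 0 (u / 3) * H (u - L)) L] at e1
  have e2 : (∫ p : ℝ, kr n e L 0 (3 * p / 3) * H (3 * p - L)) = ∫ p : ℝ, kr n e L 0 p * H (3 * p - L) := by
    refine integral_congr_ae (ae_of_all _ fun p => ?_)
    beta_reduce
    rw [mul_div_cancel_left₀ p (by norm_num : (3:ℝ) ≠ 0)]
  rw [e2] at e1
  rw [e1, Gk, mu2, integral_prod _ (gk_integrable hH n he 0 hHi _)]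
  rw [show |(3:ℝ)⁻¹| = 1 / 3 by norm_num, Complex.real_smul, ← integral_const_mul, ← integral_const_mul]
  refine integral_congr_ae (ae_of_all _ fun v => ?_)
  beta_reduce
  rw [add_sub_cancel_right, ← intervalIntegral.integral_of_le (by linarith), kr, Jb_complex]
  have e3 : Real.exp ((v + L) / 3) = Real.exp (L / 3) * Real.exp (v / 3) := by
    rw [← Real.exp_add]; congr 1; ring
  have e4 : Real.exp ((L - (v + L) / 3) / 2) = Real.exp (L / 3) * Real.exp (-v / 6) := by
    rw [← Real.exp_add]; congr 1; ring
  rw [e3, e4]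
  set Z := Real.exp (L / 3)
  have e5 : ∀ θ : ℝ, gk H n e 0 Z (v, θ) = Complex.exp (Complex.I * e * (Z * Real.exp (v / 3) : ℝ)) * H v *
      Complex.exp (Complex.I * ((2 * (Z * Real.exp (-v / 6)) * Real.sin θ - (n : ℤ) * θ : ℝ) : ℂ)) := by
    intro θ
    rw [gk, pow_zero, one_mul, mul_right_comm, ← Complex.exp_add]
    congr 2
    simp only [ph]
    push_cast
    ring
  simp_rw [e5]
  rw [intervalIntegral.integral_const_mul]
  rw [show -((((0:ℝ):ℂ) - Complex.I * e) * ((Z * Real.exp (v / 3) : ℝ) : ℂ)) =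
    Complex.I * e * (Z * Real.exp (v / 3) : ℝ) by push_cast; ring]
  set X := ∫ θ in (-π)..π,
      Complex.exp (Complex.I * ((2 * (Z * Real.exp (-v / 6)) * Real.sin θ - (n : ℤ) * θ : ℝ) : ℂ))
  push_cast
  field_simp
  ring

lemma Phi_eq (T ε0 ρf : ℝ) (hT : 1 < T) (hε : 0 < ε0) {d : ℕ} (hd : 2 ≤ d) {y : ℝ} (hy : y ≠ 0) :
    Phiw4 T ε0 ρf d y = ((Real.sign y : ℂ) * Complex.I) ^ d / (6 * π) *
      Gk (Hw ((d - 1) ^ 3 / (32 * π ^ 3)) (9 * (d - 1) / (8 * π ^ 3)) (T ^ ε0) ρf) (d - 1)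
        (Real.sign y) 0 (2 * π * |y| ^ (1 / 3 : ℝ)) := by
  have hpi := Real.pi_pos
  have hpiC : (π:ℂ) ≠ 0 := by exact_mod_cast hpi.ne'
  have hy0 : 0 < |y| := abs_pos.2 hy
  have hyC : ((|y| : ℝ) : ℂ) ≠ 0 := by exact_mod_cast hy0.ne'
  have h2 : (2:ℝ) ≤ d := by exact_mod_cast hd
  have he : Real.sign y = 1 ∨ Real.sign y = -1 := by
    rcases lt_or_gt_of_ne hy with h | h
    · right; exact Real.sign_of_neg h
    · left; exact Real.sign_of_pos h
  set e := Real.sign y with hedef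
  set a : ℝ := (d - 1) ^ 3 / (32 * π ^ 3) with ha
  set b : ℝ := 9 * (d - 1) / (8 * π ^ 3) with hb
  set V : ℝ := T ^ ε0 with hVdef
  have hd1 : (0:ℝ) ≤ d - 1 := by linarith
  have ha0 : 0 ≤ a := by positivity
  have hb0 : 0 ≤ b := by positivity
  have hV : 1 ≤ V := Real.one_le_rpow hT.le hε.le
  have hV0 : 0 < V := by linarith
  set Y : ℝ := 8 * π ^ 3 * |y| with hY
  have hY0 : 0 < Y := by positivity
  set L := Real.log Y with hL
  have hYabs : |8 * π ^ 3 * y| = Y := by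
    rw [abs_mul, abs_of_pos (by positivity)]
  have hA : ∀ t : ℝ, Ffun T ε0 ρf ((t : ℂ) * Complex.I) * specd d ((t : ℂ) * Complex.I) = Aw a b V ρf t := by
    intro t
    rw [Ffun, specd, Aw, Complex.ofReal_mul, Complex.ofReal_exp, ← hVdef]
    congr 1
    · congr 1
      push_cast
      rw [show ((t:ℂ) * Complex.I - Complex.I * ρf) ^ 2 = (t - ρf) ^ 2 * Complex.I ^ 2 by ring,
        Complex.I_sq]; ring
    · rw [ha, hb]
      push_cast
      rw [mul_pow, Complex.I_sq]
      field_simp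
      ring
  have hK : ∀ t : ℝ, Kw4 y d ((t:ℂ) * Complex.I) = (((e : ℂ) * Complex.I) ^ d / (4 * (π : ℂ) ^ 2)) *
    (1 / (2 * (π : ℂ))) * (Y * (Complex.exp (-(t * L * Complex.I)) *
      ∫ τ : ℝ, Qfun d ((1 / 12 : ℂ) + τ * Complex.I) *
        Complex.exp (-(((1 / 12 : ℂ) + τ * Complex.I) * L)) * Rg e 0 (τ + 3 * t))) := by
    intro t
    rw [Kw4, hYabs, ← hedef]
    congr 1
    rw [← integral_const_mul, ← integral_const_mul]
    refine integral_congr_ae (ae_of_all volume fun τ => ?_)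
    beta_reduce
    rw [Rg_zero he]
    have hYC : (Y:ℂ) ≠ 0 := by exact_mod_cast hY0.ne'
    have k1 : (Y:ℂ) ^ ((1:ℂ) - t * Complex.I - (1 / 12 + τ * Complex.I)) = Y *
        (Complex.exp (-(t * L * Complex.I)) * Complex.exp (-(((1 / 12 : ℂ) + τ * Complex.I) * L))) := by
      rw [sub_sub, Complex.cpow_sub _ _ hYC, Complex.cpow_one, div_eq_mul_inv, ← Complex.cpow_neg,
        Complex.cpow_def_of_ne_zero hYC, ← Complex.ofReal_log hY0.le, ← hL, ← Complex.exp_add]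
      congr 2; ring
    rw [k1, show (1 / 12 : ℂ) + ((τ + 3 * t : ℝ) : ℂ) * Complex.I =
      1 / 12 + τ * Complex.I + 3 * (t * Complex.I) by push_cast; ring]
    ring
  have hmain := main_id (L := L) hd he (Aw_continuous a b V ρf) (Aw_integrable ha0 hb0 hV0 ρf)
    (Aw_weighted_integrable ha0 hb0 hV0 ρf) (H := Hw a b V ρf) (by
      have := Hw_integrable ha0 hb0 hV 0 le_rfl ρf
      rw [← integrable_norm_iff (Hw_continuous a b V ρf).aestronglyMeasurable]
      simpa using this) (fun v => Aw_fourier a b hV0 ρf v)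
  rw [kr_int (Hw_continuous a b V ρf) (d - 1) he (by
    have := Hw_integrable ha0 hb0 hV 0 le_rfl ρf
    simpa using this) L] at hmain
  have hZ : Real.exp (L / 3) = 2 * π * |y| ^ (1 / 3 : ℝ) := by
    rw [hL, show Real.log Y / 3 = Real.log Y * (1 / 3) by ring, ← Real.rpow_def_of_pos hY0, hY,
      show 8 * π ^ 3 = (2 * π) ^ (3:ℕ) by ring, Real.mul_rpow (by positivity) (by positivity),
      ← Real.rpow_natCast, ← Real.rpow_mul (by positivity)]
    norm_num
  rw [hZ] at hmain
  have hIntg : ∫ t : ℝ, Ffun T ε0 ρf ((t : ℂ) * Complex.I) * Kw4 y d ((t : ℂ) * Complex.I) *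
      specd d ((t : ℂ) * Complex.I) = (((e : ℂ) * Complex.I) ^ d / (4 * (π : ℂ) ^ 2)) *
    (1 / (2 * (π : ℂ))) * Y * ∫ t : ℝ, Aw a b V ρf t * Complex.exp (-(t * L * Complex.I)) *
      ∫ τ : ℝ, Qfun d ((1 / 12 : ℂ) + τ * Complex.I) *
        Complex.exp (-(((1 / 12 : ℂ) + τ * Complex.I) * L)) * Rg e 0 (τ + 3 * t) := by
    rw [← integral_const_mul]
    refine integral_congr_ae (ae_of_all _ fun t => ?_)
    beta_reduce
    rw [mul_right_comm, hA, hK]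
    ring
  rw [Phiw4, hIntg, hmain, hY]
  push_cast
  field_simp
  ring

def cc : ℕ → ℕ → ℝ
  | 0, 0 => 1
  | 0, _ + 1 => 0
  | j + 1, 0 => (-(j:ℝ)) * cc j 0
  | j + 1, k + 1 => (((k:ℝ) + 1) / 3 - j) * cc j (k + 1) + (2 * π / 3) * cc j k

lemma cc_zero_of_lt (j : ℕ) : ∀ k, j < k → cc j k = 0 := by
  induction j with
  | zero =>
    intro k hk
    cases k with
    | zero => omega
    | succ k => rw [cc]
  | succ j ih =>
    intro k hk
    cases k with
    | zero => omega
    | succ k => rw [cc, ih (k + 1) (by omega), ih k (by omega)]; ring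

lemma cc_sum (j : ℕ) (f : ℕ → ℂ) :
    ∑ k ∈ Finset.range (j + 1 + 1), (cc (j + 1) k : ℂ) * f k =
      ∑ k ∈ Finset.range (j + 1), (cc j k : ℂ) * (((k:ℂ) / 3 - j) * f k + (2 * π / 3) * f (k + 1)) := by
  have h1 : ∑ k ∈ Finset.range (j + 1), (cc j k : ℂ) * (((k:ℂ) / 3 - j) * f k) =
      ∑ k ∈ Finset.range (j + 1 + 1), (cc j k : ℂ) * (((k:ℂ) / 3 - j) * f k) := by
    rw [Finset.sum_range_succ _ (j + 1), cc_zero_of_lt j (j + 1) (by omega)]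
    simp
  simp_rw [mul_add]
  rw [Finset.sum_add_distrib, h1, Finset.sum_range_succ' _ (j + 1), Finset.sum_range_succ' _ (j + 1),
    add_right_comm, ← Finset.sum_add_distrib]
  congr 1
  · refine Finset.sum_congr rfl fun k _ => ?_
    rw [cc]
    push_cast
    ring
  · rw [cc]
    push_cast
    ring

def Df (G : ℝ → ℕ → ℝ → ℂ) (j : ℕ) (y : ℝ) : ℂ :=
  (Real.sign y : ℂ) ^ j * ∑ k ∈ Finset.range (j + 1), (cc j k : ℂ) *
    (((|y| ^ ((k:ℝ) / 3 - j) : ℝ) : ℂ) * G (Real.sign y) k (2 * π * |y| ^ (1 / 3 : ℝ)))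

lemma Df_hasDerivAt {G : ℝ → ℕ → ℝ → ℂ}
    (hG : ∀ e, (e = 1 ∨ e = -1) → ∀ k Z, HasDerivAt (G e k) (G e (k + 1) Z) Z) (j : ℕ)
    {y : ℝ} (hy : y ≠ 0) : HasDerivAt (Df G j) (Df G (j + 1) y) y := by
  have hs : ∃ e : ℝ, (e = 1 ∨ e = -1) ∧ ∀ᶠ x in nhds y, Real.sign x = e ∧ |x| = e * x := by
    rcases lt_or_gt_of_ne hy with h | h
    · refine ⟨-1, Or.inr rfl, ?_⟩
      filter_upwards [gt_mem_nhds h] with x hx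
      exact ⟨Real.sign_of_neg hx, by rw [abs_of_neg hx]; ring⟩
    · refine ⟨1, Or.inl rfl, ?_⟩
      filter_upwards [lt_mem_nhds h] with x hx
      exact ⟨Real.sign_of_pos hx, by rw [abs_of_pos hx]; ring⟩
  obtain ⟨e, he, hev⟩ := hs
  obtain ⟨hy1, hy2⟩ := hev.self_of_nhds
  have hu0 : 0 < e * y := by rw [← hy2]; exact abs_pos.2 hy
  have hE : Df G j =ᶠ[nhds y] fun x => (e : ℂ) ^ j * ∑ k ∈ Finset.range (j + 1), (cc j k : ℂ) *
    ((((e * x) ^ ((k:ℝ) / 3 - j) : ℝ) : ℂ) * G e k (2 * π * (e * x) ^ (1 / 3 : ℝ))) := by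
    filter_upwards [hev] with x hx
    rw [Df, hx.1, hx.2]
  refine HasDerivAt.congr_of_eventuallyEq ?_ hE
  rw [Df, hy1, hy2]
  set u := e * y with hu
  have hue : HasDerivAt (fun x : ℝ => e * x) e y := by
    simpa using (hasDerivAt_id y).const_mul e
  have hp : ∀ α : ℝ, HasDerivAt (fun x : ℝ => (e * x) ^ α) (e * α * u ^ (α - 1)) y := fun α =>
    hue.rpow_const (Or.inl hu0.ne')
  have hZ : HasDerivAt (fun x : ℝ => 2 * π * (e * x) ^ (1 / 3 : ℝ))
      (2 * π * (e * (1 / 3) * u ^ ((1 / 3 : ℝ) - 1))) y := (hp (1 / 3)).const_mul (2 * π)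
  have ht : ∀ k : ℕ, HasDerivAt (fun x : ℝ => (cc j k : ℂ) *
      ((((e * x) ^ ((k:ℝ) / 3 - j) : ℝ) : ℂ) * G e k (2 * π * (e * x) ^ (1 / 3 : ℝ))))
      ((cc j k : ℂ) * ((e * ((k:ℝ) / 3 - j) * u ^ ((k:ℝ) / 3 - j - 1) : ℝ) *
        G e k (2 * π * u ^ (1 / 3 : ℝ)) + (u ^ ((k:ℝ) / 3 - j) : ℝ) *
        ((2 * π * (e * (1 / 3) * u ^ ((1 / 3 : ℝ) - 1)) : ℝ) *
          G e (k + 1) (2 * π * u ^ (1 / 3 : ℝ))))) y := by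
    intro k
    have h1 := HasDerivAt.scomp y (hG e he k (2 * π * u ^ (1 / 3 : ℝ))) hZ
    have h2 := ((hp ((k:ℝ) / 3 - j)).ofReal_comp.mul h1).const_mul (cc j k : ℂ)
    refine h2.congr_deriv ?_
    simp [← hu]
  have hsum := (HasDerivAt.fun_sum (u := Finset.range (j + 1)) fun k _ => ht k).const_mul ((e:ℂ) ^ j)
  refine hsum.congr_deriv ?_
  rw [cc_sum, pow_succ, mul_assoc ((e:ℂ) ^ j) (e:ℂ)]
  congr 1
  rw [Finset.mul_sum]
  refine Finset.sum_congr rfl fun k _ => ?_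
  have e1 : u ^ ((k:ℝ) / 3 - (j + 1 : ℕ)) = u ^ ((k:ℝ) / 3 - j - 1) := by
    congr 1; push_cast; ring
  have e2 : u ^ (((k + 1 : ℕ):ℝ) / 3 - (j + 1 : ℕ)) = u ^ ((k:ℝ) / 3 - j) * u ^ ((1 / 3 : ℝ) - 1) := by
    rw [← Real.rpow_add hu0]; congr 1; push_cast; ring
  rw [e1, e2]
  push_cast
  ring

lemma ne_open : IsOpen {y : ℝ | y ≠ 0} := isOpen_ne

lemma Df_iterated {G : ℝ → ℕ → ℝ → ℂ} {Φ : ℝ → ℂ}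
    (hG : ∀ e, (e = 1 ∨ e = -1) → ∀ k Z, HasDerivAt (G e k) (G e (k + 1) Z) Z)
    (hΦ : ∀ y, y ≠ 0 → Φ y = Df G 0 y) (j : ℕ) :
    ∀ y ∈ {y : ℝ | y ≠ 0}, iteratedDerivWithin j Φ {y | y ≠ 0} y = Df G j y := by
  induction j with
  | zero => intro y hy; simpa using hΦ y hy
  | succ j ih =>
    intro y hy
    rw [iteratedDerivWithin_succ, derivWithin_congr ih (ih y hy),
      derivWithin_of_isOpen ne_open hy, (Df_hasDerivAt hG j hy).deriv]

lemma Df_contDiffOn {G : ℝ → ℕ → ℝ → ℂ} {Φ : ℝ → ℂ}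
    (hG : ∀ e, (e = 1 ∨ e = -1) → ∀ k Z, HasDerivAt (G e k) (G e (k + 1) Z) Z)
    (hΦ : ∀ y, y ≠ 0 → Φ y = Df G 0 y) (j : ℕ∞) :
    ContDiffOn ℝ j Φ {y | y ≠ 0} := by
  refine contDiffOn_of_differentiableOn_deriv fun m _ => ?_
  refine DifferentiableOn.congr (f := Df G m) (fun y hy =>
    (Df_hasDerivAt hG m hy).differentiableAt.differentiableWithinAt) (Df_iterated hG hΦ m)

lemma Df_bound {G : ℝ → ℕ → ℝ → ℂ} {M : ℕ → ℝ} {B : ℝ} (hB : 0 ≤ B) (hM : ∀ k, 0 ≤ M k)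
    (hG : ∀ e, (e = 1 ∨ e = -1) → ∀ k Z, ‖G e k Z‖ ≤ M k * B) (j : ℕ) {T y : ℝ} (hT : 1 < T)
    (hy : y ≠ 0) :
    |y| ^ j * ‖Df G j y‖ ≤ (∑ k ∈ Finset.range (j + 1), |cc j k| * M k) * B *
      (T + |y| ^ ((1:ℝ) / 3)) ^ j := by
  have hy0 : 0 < |y| := abs_pos.2 hy
  have he : Real.sign y = 1 ∨ Real.sign y = -1 := by
    rcases lt_or_gt_of_ne hy with h | h
    · right; exact Real.sign_of_neg h
    · left; exact Real.sign_of_pos h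
  have hes : ‖((Real.sign y : ℂ)) ^ j‖ = 1 := by
    rcases he with h | h <;> simp [h]
  rw [Df, norm_mul, hes, one_mul]
  have h1 : |y| ^ j * ‖∑ k ∈ Finset.range (j + 1), (cc j k : ℂ) *
      (((|y| ^ ((k:ℝ) / 3 - j) : ℝ) : ℂ) * G (Real.sign y) k (2 * π * |y| ^ (1 / 3 : ℝ)))‖ ≤
      |y| ^ j * ∑ k ∈ Finset.range (j + 1), ‖(cc j k : ℂ) *
      (((|y| ^ ((k:ℝ) / 3 - j) : ℝ) : ℂ) * G (Real.sign y) k (2 * π * |y| ^ (1 / 3 : ℝ)))‖ := by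
    gcongr
    exact norm_sum_le _ _
  refine h1.trans ?_
  rw [Finset.mul_sum, Finset.sum_mul, Finset.sum_mul]
  refine Finset.sum_le_sum fun k hk => ?_
  have hkj : k ≤ j := by have := Finset.mem_range.1 hk; omega
  rw [norm_mul, norm_mul, Complex.norm_real, Complex.norm_real, Real.norm_eq_abs, Real.norm_eq_abs,
    abs_of_pos (Real.rpow_pos_of_pos hy0 _)]
  set x := |y| ^ ((1:ℝ) / 3) with hx
  have hx0 : 0 < x := Real.rpow_pos_of_pos hy0 _
  have e1 : |y| ^ j * |y| ^ ((k:ℝ) / 3 - j) = x ^ k := by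
    rw [hx, ← Real.rpow_natCast, ← Real.rpow_natCast, ← Real.rpow_add hy0, ← Real.rpow_mul hy0.le]
    congr 1; ring
  have e2 : x ^ k ≤ (T + x) ^ j :=
    (pow_le_pow_left₀ hx0.le (by linarith) k).trans (pow_le_pow_right₀ (by linarith) hkj)
  have e3 := hG _ he k (2 * π * x)
  have e4 : x ^ k * ‖G (Real.sign y) k (2 * π * x)‖ ≤ (T + x) ^ j * (M k * B) :=
    mul_le_mul e2 e3 (norm_nonneg _) (by positivity)
  calc _ = |cc j k| * ((|y| ^ j * |y| ^ ((k:ℝ) / 3 - j)) * ‖G (Real.sign y) k (2 * π * x)‖) := by ring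
    _ ≤ |cc j k| * ((T + x) ^ j * (M k * B)) := by
        rw [e1]; exact mul_le_mul_of_nonneg_left e4 (abs_nonneg _)
    _ = _ := by ring

def Gx (T ε0 ρf : ℝ) (d : ℕ) (e : ℝ) (k : ℕ) (Z : ℝ) : ℂ :=
  ((e : ℂ) * Complex.I) ^ d / (6 * π) *
      Gk (Hw ((d - 1) ^ 3 / (32 * π ^ 3)) (9 * (d - 1) / (8 * π ^ 3)) (T ^ ε0) ρf) (d - 1) e k Z

lemma Bx_le {c1 c2 T ε0 ρf : ℝ} (hc1 : 0 < c1) (hc12 : c1 ≤ c2) (hε : 0 < ε0) (hT : 1 < T) {d : ℕ}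
    (hd : 2 ≤ d) (hd2 : (d:ℝ) ≤ c2 * T) (hρ : |ρf| ≤ c2 * T) :
    ((d:ℝ) - 1) ^ 3 / (32 * π ^ 3) + 2 * (9 * ((d:ℝ) - 1) / (8 * π ^ 3)) * ρf ^ 2 +
      2 * (9 * ((d:ℝ) - 1) / (8 * π ^ 3)) * T ^ ε0 ≤
      (c2 ^ 3 + 3 * c2 ^ 3 + 3 * c2) * T ^ ((3:ℝ) + ε0) := by
  have hpi := Real.pi_gt_three
  have hc2 : 0 < c2 := by linarith
  have h2 : (2:ℝ) ≤ d := by exact_mod_cast hd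
  set n := (d:ℝ) - 1 with hn
  have hn0 : 0 ≤ n := by linarith
  have hn1 : n ≤ c2 * T := by linarith
  have hV : 1 ≤ T ^ ε0 := Real.one_le_rpow hT.le hε.le
  have hT0 : 0 < T := by linarith
  rw [Real.rpow_add hT0, show T ^ (3:ℝ) = T ^ (3:ℕ) by rw [← Real.rpow_natCast]; norm_num]
  set V := T ^ ε0
  have hp1 : 1 ≤ π ^ 3 := one_le_pow₀ (by linarith)
  have hn3 : n ^ 3 ≤ (c2 * T) ^ 3 := pow_le_pow_left₀ hn0 hn1 3
  have hr2 : ρf ^ 2 ≤ (c2 * T) ^ 2 := by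
    rw [← sq_abs]; exact pow_le_pow_left₀ (abs_nonneg _) hρ 2
  have a1 : n ^ 3 / (32 * π ^ 3) ≤ n ^ 3 := div_le_self (by positivity) (by linarith)
  have a2 : 2 * (9 * n / (8 * π ^ 3)) ≤ 3 * n := by
    rw [show 2 * (9 * n / (8 * π ^ 3)) = (9 / 4 * n) / π ^ 3 by field_simp; ring]
    refine (div_le_self (by positivity) hp1).trans (by linarith)
  have hT3 : 0 < T ^ 3 := by positivity
  have b1 : n ^ 3 / (32 * π ^ 3) ≤ c2 ^ 3 * (T ^ 3 * V) := by
    calc _ ≤ c2 ^ 3 * T ^ 3 := by rw [← mul_pow]; linarith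
      _ ≤ _ := by
        refine mul_le_mul_of_nonneg_left ?_ (by positivity)
        nlinarith
  have b2 : 2 * (9 * n / (8 * π ^ 3)) * ρf ^ 2 ≤ 3 * c2 ^ 3 * (T ^ 3 * V) := by
    calc _ ≤ (3 * (c2 * T)) * (c2 * T) ^ 2 :=
          mul_le_mul (a2.trans (by linarith)) hr2 (sq_nonneg _) (by positivity)
      _ = 3 * c2 ^ 3 * T ^ 3 := by ring
      _ ≤ _ := by
        refine mul_le_mul_of_nonneg_left ?_ (by positivity)
        nlinarith
  have b3 : 2 * (9 * n / (8 * π ^ 3)) * V ≤ 3 * c2 * (T ^ 3 * V) := by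
    calc _ ≤ (3 * (c2 * T)) * V := mul_le_mul_of_nonneg_right (a2.trans (by linarith)) (by linarith)
      _ = 3 * c2 * (T * V) := by ring
      _ ≤ _ := by
        refine mul_le_mul_of_nonneg_left ?_ (by positivity)
        refine mul_le_mul_of_nonneg_right ?_ (by linarith)
        exact le_self_pow₀ hT.le (by norm_num)
  linarith

def Mx (k : ℕ) : ℝ := 3 ^ k * (2 * π) * (8 * √π * Real.exp (4 * ((k:ℝ) / 3) ^ 2) * (4 * √π))

/-- Lemma 3, derivative bounds for `Φ_{w₄}`: fix `0 < c₁ ≤ c₂`,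
`ε > 0` and `j ≥ 0`. There is `C` such that for all `T > 1`, `d ≍ T` and `|ρ_f| ≍ T`,
the function `y ↦ Φ_{w₄}(y; d)` is `j` times continuously differentiable on `ℝ∖{0}`
and `|y|^j |Φ_{w₄}^{(j)}(y; d)| ≤ C T^{3+ε} (T + |y|^{1/3})^j` for all `y ≠ 0`. -/
theorem statement15 (c1 c2 ε0 : ℝ) (j : ℕ) (hc1 : 0 < c1) (hc12 : c1 ≤ c2)
    (hε : 0 < ε0) :
    ∃ C : ℝ,
      ∀ T : ℝ, 1 < T →
        ∀ d : ℕ, 2 ≤ d → c1 * T ≤ (d : ℝ) → (d : ℝ) ≤ c2 * T →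
          ∀ ρf : ℝ, c1 * T ≤ |ρf| → |ρf| ≤ c2 * T →
            ContDiffOn ℝ (j : ℕ∞) (fun y : ℝ => Phiw4 T ε0 ρf d y) {y : ℝ | y ≠ 0} ∧
            ∀ y : ℝ, y ≠ 0 →
              |y| ^ j *
                ‖iteratedDerivWithin j (fun y : ℝ => Phiw4 T ε0 ρf d y) {y : ℝ | y ≠ 0} y‖
                ≤ C * T ^ ((3 : ℝ) + ε0) * (T + |y| ^ ((1 : ℝ) / 3)) ^ j := by
  have hpi := Real.pi_gt_three
  refine ⟨(∑ k ∈ Finset.range (j + 1), |cc j k| * Mx k) * (c2 ^ 3 + 3 * c2 ^ 3 + 3 * c2), ?_⟩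
  intro T hT d hd _ hd2 ρf _ hρ
  have h2 : (2:ℝ) ≤ d := by exact_mod_cast hd
  have hd1 : (0:ℝ) ≤ d - 1 := by linarith
  have ha0 : 0 ≤ ((d:ℝ) - 1) ^ 3 / (32 * π ^ 3) := by positivity
  have hb0 : 0 ≤ 9 * ((d:ℝ) - 1) / (8 * π ^ 3) := by positivity
  have hV : 1 ≤ T ^ ε0 := Real.one_le_rpow hT.le hε.le
  have hB0 := Bx_le hc1 hc12 hε hT hd hd2 hρ
  have hHi : ∀ k : ℕ, Integrable (fun v => Real.exp (k / 3 * |v|) *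
      ‖Hw (((d:ℝ) - 1) ^ 3 / (32 * π ^ 3)) (9 * ((d:ℝ) - 1) / (8 * π ^ 3)) (T ^ ε0) ρf v‖) :=
    fun k => Hw_integrable ha0 hb0 hV (k / 3) (by positivity) ρf
  have hG : ∀ e, (e = 1 ∨ e = -1) → ∀ k Z,
      HasDerivAt (Gx T ε0 ρf d e k) (Gx T ε0 ρf d e (k + 1) Z) Z := fun e he k Z =>
    (Gk_hasDerivAt (Hw_continuous _ _ _ ρf) (d - 1) he k hHi Z).const_mul _
  have hΦ : ∀ y, y ≠ 0 → (fun y : ℝ => Phiw4 T ε0 ρf d y) y = Df (Gx T ε0 ρf d) 0 y := by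
    intro y hy
    beta_reduce
    rw [Phi_eq T ε0 ρf hT hε hd hy, Df]
    simp [Gx, cc]
  have hB : 0 ≤ (c2 ^ 3 + 3 * c2 ^ 3 + 3 * c2) * T ^ ((3:ℝ) + ε0) := le_trans (by positivity) hB0
  have hbd : ∀ e, (e = 1 ∨ e = -1) → ∀ k Z, ‖Gx T ε0 ρf d e k Z‖ ≤
      Mx k * ((c2 ^ 3 + 3 * c2 ^ 3 + 3 * c2) * T ^ ((3:ℝ) + ε0)) := by
    intro e he k Z
    have hn : ‖((e : ℂ) * Complex.I) ^ d / (6 * π)‖ ≤ 1 := by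
      have : ‖((e : ℂ) * Complex.I) ^ d‖ = 1 := by rcases he with h | h <;> simp [h]
      rw [norm_div, this]
      refine div_le_one_of_le₀ ?_ (norm_nonneg _)
      rw [show (6 * π : ℂ) = ((6 * π : ℝ) : ℂ) by push_cast; rfl, Complex.norm_real, Real.norm_eq_abs,
        abs_of_pos (by positivity)]
      linarith
    have hk := Gk_norm_le (d - 1) he k (hHi k) Z
    have hI := Hw_integral_le ha0 hb0 hV (k / 3) (by positivity) ρf
    rw [Gx, norm_mul]
    calc _ ≤ 1 * (3 ^ k * (2 * π) * ((8 * √π * Real.exp (4 * ((k:ℝ) / 3) ^ 2)) *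
          ((c2 ^ 3 + 3 * c2 ^ 3 + 3 * c2) * T ^ ((3:ℝ) + ε0)) * (4 * √π))) := by
          refine mul_le_mul hn (hk.trans ?_) (norm_nonneg _) zero_le_one
          refine mul_le_mul_of_nonneg_left (hI.trans ?_) (by positivity)
          refine mul_le_mul_of_nonneg_right ?_ (by positivity)
          exact mul_le_mul_of_nonneg_left hB0 (by positivity)
      _ = _ := by rw [Mx]; ring
  refine ⟨Df_contDiffOn hG hΦ j, fun y hy => ?_⟩
  rw [Df_iterated hG hΦ j y hy]
  refine (Df_bound hB (fun k => by rw [Mx]; positivity) hbd j hT hy).trans_eq ?_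
  ring
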